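/- arXiv:2406.01910 — 8 statements merged into one kernel-verified Lean document; each statement's English description precedes it below -/
import Mathlib

section
/- Let G = (V,E) be a finite simple connected undirected graph on n vertices and let f : V → {1,…,n} be a valuation with maximum value M_f = max_{v∈V} f(v). Then there exists a finite sequence of vertices v₁, v₂, …, v_m such that applying the asynchronous maximum update at v₁, then v₂, …, then v_m in order transforms f into the constant valuation assigning M_f to every vertex. -/
open MeasureTheory
open scoped ENNReal

attribute [local instance] Classical.propDecidable

/-- The neighbours of `v` in `G`, as a finset. -/
noncomputable def nbrs {V : Type*} [Fintype V] (G : SimpleGraph V) (v : V) : Finset V :=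
  Finset.univ.filter (fun u => G.Adj v u)

/-- The asynchronous maximum update of a valuation `f` at the vertex `v`:
the value at `v` is replaced by the maximum of `f` over the neighbours of `v`
(if `v` has at least one neighbour; otherwise nothing changes), and all other
values are unchanged. -/
noncomputable def amUpdate {V : Type*} [Fintype V] (G : SimpleGraph V)
    (f : V → ℕ) (v : V) : V → ℕ :=
  fun u => if u = v ∧ (nbrs G v).Nonempty then (nbrs G v).sup f else f u

/-- Updating a vertex with a neighbour of maximum value gives that vertex the maximum value. -/
theorem amUpdate_eq_update {V : Type*} [Fintype V] {G : SimpleGraph V} {f : V → ℕ} {M : ℕ}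
    (hf : ∀ v, f v ≤ M) {v w : V} (hvw : G.Adj v w) (hw : f w = M) :
    amUpdate G f v = Function.update f v M := by
  have hmem : w ∈ nbrs G v := by simp [nbrs, hvw]
  have hsup : (nbrs G v).sup f = M :=
    le_antisymm (Finset.sup_le fun x _ => hf x) (hw ▸ Finset.le_sup hmem)
  have hne : (nbrs G v).Nonempty := ⟨w, hmem⟩
  ext u
  by_cases hu : u = v <;> simp [amUpdate, hu, hne, hsup]

/-- On a connected graph, an attained upper bound spreads to all vertices: repeatedly update a
vertex below the bound that has a neighbour attaining it. -/
theorem exists_foldl_amUpdate_eq_const {V : Type*} [Fintype V] {G : SimpleGraph V}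
    (hG : G.Connected) (M : ℕ) (f : V → ℕ) (hf : ∀ v, f v ≤ M) (hM : ∃ v, f v = M) :
    ∃ L : List V, L.foldl (amUpdate G) f = fun _ => M := by
  induction hk : (Finset.univ.filter fun v => f v ≠ M).card using Nat.strong_induction_on
    generalizing f with
  | _ k ih =>
    by_cases hall : ∀ v, f v = M
    · exact ⟨[], funext hall⟩
    obtain ⟨a, ha⟩ := hM
    push Not at hall
    obtain ⟨b, hb⟩ := hall
    obtain ⟨p⟩ := hG.preconnected a b
    obtain ⟨d, -, hd, hd'⟩ := p.exists_boundary_dart {v | f v = M} ha hb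
    have hupd := amUpdate_eq_update hf d.adj.symm hd
    obtain ⟨L, hL⟩ := ih _ (hk ▸ Finset.card_lt_card (t := Finset.univ.filter fun v => f v ≠ M)
      (s := Finset.univ.filter fun v => Function.update f d.snd M v ≠ M) (by
        refine Finset.ssubset_iff_of_subset (fun v hv => ?_) |>.2 ⟨d.snd, ?_, ?_⟩
        · by_cases h : v = d.snd <;> simp_all [Function.update_apply]
        · simpa using hd'
        · simp)) (Function.update f d.snd M)
      (fun v => by by_cases h : v = d.snd <;> simp [h, hf])
      ⟨d.snd, by simp⟩ rfl
    exact ⟨d.snd :: L, by rw [List.foldl_cons, hupd, hL]⟩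

/-- for a finite simple connected undirected graph on `n` vertices and a
valuation `f : V → {1,…,n}`, there is a finite sequence of vertices such that applying the
asynchronous maximum updates at these vertices in order transforms `f` into the constant
valuation assigning the maximum value `M_f = max_v f v` to every vertex. -/
theorem exists_update_seq_to_const {V : Type*} [Fintype V] (n : ℕ)
    (hn : Fintype.card V = n) (G : SimpleGraph V) (hG : G.Connected)
    (f : V → ℕ) (hf : ∀ v, f v ∈ Finset.Icc 1 n) :
    ∃ L : List V, L.foldl (amUpdate G) f = fun _ => Finset.univ.sup f := by
  have := hG.nonempty
  obtain ⟨v, -, hv⟩ := Finset.exists_mem_eq_sup Finset.univ Finset.univ_nonempty f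
  exact exists_foldl_amUpdate_eq_const hG _ f (fun v => Finset.le_sup (Finset.mem_univ v))
    ⟨v, hv.symm⟩
end

section
/- Let G = (V,E) be a finite simple connected undirected graph on n vertices. For valuations f, g : V → {1,…,n}, say g is reachable from f if g is obtained from f by applying a finite (possibly empty) sequence of asynchronous maximum updates. If f is a valuation such that for every valuation g reachable from f, the valuation f is also reachable from g (i.e., f lies in an absorbing strongly connected component of the Markov chain of possibilities), then f is a constant valuation. Consequently every absorbing component consists of exactly one valuation, which is constant; that is, the period of the asynchronous maximum model on an undirected graph is 1. -/
open MeasureTheory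
open scoped ENNReal

attribute [local instance] Classical.propDecidable

/-- `g` is reachable from `f` if it is obtained from `f` by a finite (possibly empty)
sequence of asynchronous maximum updates. -/
def amReachable {V : Type*} [Fintype V] (G : SimpleGraph V) : (V → ℕ) → (V → ℕ) → Prop :=
  Relation.ReflTransGen (fun f g => ∃ v, g = amUpdate G f v)

theorem amUpdate_of_ne {V : Type*} [Fintype V] (G : SimpleGraph V) (f : V → ℕ) {u v : V}
    (h : u ≠ v) : amUpdate G f v u = f u := by
  simp [amUpdate, h]

/-- Updating a neighbour of a vertex carrying the maximal value `m` yields the value `m`. -/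
theorem amUpdate_self_of_adj {V : Type*} [Fintype V] (G : SimpleGraph V) {f : V → ℕ} {m : ℕ}
    (hle : ∀ v, f v ≤ m) {v w : V} (hadj : G.Adj v w) (hw : f w = m) :
    amUpdate G f v v = m := by
  have hmem : w ∈ nbrs G v := by simp [nbrs, hadj]
  have hne : (nbrs G v).Nonempty := ⟨w, hmem⟩
  simp only [amUpdate, hne, and_self, if_true]
  exact le_antisymm (Finset.sup_le fun u _ => hle u) (hw ▸ Finset.le_sup (f := f) hmem)

/-- Constant valuations are fixed by every update. -/
theorem amUpdate_const {V : Type*} [Fintype V] (G : SimpleGraph V) (m : ℕ) (v : V) :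
    amUpdate G (fun _ => m) v = fun _ => m := by
  funext u
  unfold amUpdate
  split_ifs with h
  · exact Finset.sup_const h.2 m
  · rfl

theorem eq_const_of_amReachable_const {V : Type*} [Fintype V] (G : SimpleGraph V) {m : ℕ}
    {g : V → ℕ} (h : amReachable G (fun _ => m) g) : g = fun _ => m := by
  induction h with
  | refl => rfl
  | tail _ hstep ih =>
    obtain ⟨v, rfl⟩ := hstep
    rw [ih, amUpdate_const]

/-- On a connected graph, the maximal value of a valuation can be spread to all vertices. -/
theorem amReachable_const_of_max {V : Type*} [Fintype V] (G : SimpleGraph V)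
    (hG : G.Connected) {m : ℕ} (f : V → ℕ) (hle : ∀ v, f v ≤ m) {x : V} (hx : f x = m) :
    amReachable G f (fun _ => m) := by
  induction hk : (Finset.univ.filter fun v => f v ≠ m).card using Nat.strong_induction_on
    generalizing f with
  | _ k ih =>
    by_cases hall : ∀ v, f v = m
    · rw [show f = fun _ => m from funext hall]
      exact Relation.ReflTransGen.refl
    · push Not at hall
      obtain ⟨y, hy⟩ := hall
      obtain ⟨p⟩ := hG.preconnected x y
      obtain ⟨d, -, hd₁, hd₂⟩ := p.exists_boundary_dart {v | f v = m} hx hy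
      have hv : amUpdate G f d.snd d.snd = m := amUpdate_self_of_adj G hle d.adj.symm hd₁
      have heq : ∀ u, u ≠ d.snd → amUpdate G f d.snd u = f u :=
        fun u hu => amUpdate_of_ne G f hu
      refine Relation.ReflTransGen.head ⟨d.snd, rfl⟩ (ih _ ?_ _ ?_ ?_ rfl)
      · rw [← hk]
        apply Finset.card_lt_card
        refine Finset.ssubset_iff_of_subset ?_ |>.2 ⟨d.snd, by simpa using hd₂, by simp [hv]⟩
        intro u hu
        by_cases h : u = d.snd
        · subst h
          simp [hv] at hu
        · simpa [heq u h] using hu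
      · intro u
        by_cases h : u = d.snd
        · rw [h, hv]
        · exact (heq u h).trans_le (hle u)
      · by_cases h : x = d.snd
        · exact h ▸ hv
        · exact (heq x h).trans hx

/-- if a valuation `f` on a finite simple connected undirected graph lies in an
absorbing strongly connected component of the Markov chain of possibilities (that is, `f` is
reachable back from every valuation reachable from `f`), then `f` is a constant valuation.
Hence every absorbing component consists of exactly one, constant, valuation: the period of
the asynchronous maximum model on an undirected graph is `1`. -/
theorem absorbing_implies_const {V : Type*} [Fintype V] (n : ℕ)
    (hn : Fintype.card V = n) (G : SimpleGraph V) (hG : G.Connected)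
    (f : V → ℕ) (hf : ∀ v, f v ∈ Finset.Icc 1 n)
    (habs : ∀ g : V → ℕ, amReachable G f g → amReachable G g f) :
    ∃ c : ℕ, f = fun _ => c := by
  have := hG.nonempty
  obtain ⟨x, hx⟩ := Finite.exists_max f
  exact ⟨f x, eq_const_of_amReachable_const G
    (habs _ (amReachable_const_of_max G hG f hx rfl))⟩
end

section
/- Let G = (V,E) be a finite simple connected undirected graph on n vertices, let f : V → {1,…,n} be a valuation, let v' ∈ V be any vertex, and let f' be the result of the asynchronous maximum update of f at v'. Then the strong edge set of f is contained in the strong edge set of f', i.e., S_f ⊆ S_{f'}. In particular the potential function f ↦ |S_f| is nonnegative, bounded above by n, and nondecreasing along any sequence of asynchronous maximum updates. -/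
open MeasureTheory
open scoped ENNReal

attribute [local instance] Classical.propDecidable

/-- The strong edge set of a valuation `f`: the set of vertices incident to a strong edge,
i.e. an edge both of whose endpoints carry the maximum value `M_f = max_v f v`. -/
def strongEdgeSet {V : Type*} [Fintype V] (G : SimpleGraph V) (f : V → ℕ) : Set V :=
  {x | ∃ u, G.Adj x u ∧ f x = Finset.univ.sup f ∧ f u = Finset.univ.sup f}

theorem amUpdate_le_sup {V : Type*} [Fintype V] (G : SimpleGraph V) (f : V → ℕ) (v u : V) :
    amUpdate G f v u ≤ Finset.univ.sup f := by
  unfold amUpdate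
  split_ifs
  · exact Finset.sup_mono (Finset.subset_univ _)
  · exact Finset.le_sup (Finset.mem_univ u)

/-- An endpoint of a strong edge keeps the maximum value under any update. -/
theorem amUpdate_eq_sup_of_adj {V : Type*} [Fintype V] (G : SimpleGraph V) (f : V → ℕ) (v : V)
    {x u : V} (hxu : G.Adj x u) (hx : f x = Finset.univ.sup f) (hu : f u = Finset.univ.sup f) :
    amUpdate G f v x = Finset.univ.sup f := by
  refine le_antisymm (amUpdate_le_sup G f v x) ?_
  unfold amUpdate
  split_ifs with h
  · obtain ⟨rfl, -⟩ := h
    rw [← hu]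
    exact Finset.le_sup (by simpa [nbrs] using hxu)
  · exact hx.ge

/-- the strong edge set can only grow under an asynchronous maximum update;
in particular the potential function `f ↦ |S_f|` is nonnegative, bounded above by `n` and
nondecreasing along any sequence of updates. -/
theorem strongEdgeSet_mono {V : Type*} [Fintype V] (n : ℕ)
    (hn : Fintype.card V = n) (G : SimpleGraph V) (hG : G.Connected)
    (f : V → ℕ) (hf : ∀ v, f v ∈ Finset.Icc 1 n) (v' : V) :
    strongEdgeSet G f ⊆ strongEdgeSet G (amUpdate G f v') ∧
    (strongEdgeSet G f).ncard ≤ n := by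
  refine ⟨?_, ?_⟩
  · rintro x ⟨u, hxu, hx, hu⟩
    have hx' := amUpdate_eq_sup_of_adj G f v' hxu hx hu
    have hu' := amUpdate_eq_sup_of_adj G f v' hxu.symm hu hx
    have hsup : Finset.univ.sup (amUpdate G f v') = Finset.univ.sup f :=
      le_antisymm (Finset.sup_le fun w _ => amUpdate_le_sup G f v' w)
        (hx' ▸ Finset.le_sup (Finset.mem_univ x))
    exact ⟨u, hxu, hx'.trans hsup.symm, hu'.trans hsup.symm⟩
  · rw [← hn, ← Nat.card_eq_fintype_card]
    exact Set.ncard_le_card _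
end

section
/- Let G = (V,E) be a finite simple connected undirected graph on n ≥ 3 vertices. Let f' be any valuation assigning the value 2 to two adjacent vertices and the value 1 to every other vertex. Then the expected convergence time satisfies T(G,f') ≥ n·H_{n−2}, where H_m = Σ_{i=1}^m 1/i is the m-th harmonic number. In particular the convergence time 𝒯(G) = max_f T(G,f) is Ω(n log n) for every connected undirected graph. -/
open MeasureTheory
open scoped ENNReal

attribute [local instance] Classical.propDecidable

/-- The asynchronous maximum model: starting from the valuation `f`, at round `t` the vertex
`ω t` is chosen and updated. `amRun G f ω t` is the valuation after `t` rounds. -/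
noncomputable def amRun {V : Type*} [Fintype V] (G : SimpleGraph V)
    (f : V → ℕ) (ω : ℕ → V) : ℕ → V → ℕ
  | 0 => f
  | (t + 1) => amUpdate G (amRun G f ω t) (ω t)

/-- The convergence time along the update sequence `ω`: the least `t` such that the valuation
after `t` rounds is constant, and `∞` if no such `t` exists (as a value in `ℝ≥0∞`). -/
noncomputable def convTime {V : Type*} [Fintype V] (G : SimpleGraph V)
    (f : V → ℕ) (ω : ℕ → V) : ℝ≥0∞ :=
  ⨅ (t : ℕ) (_ : ∃ c : ℕ, amRun G f ω t = fun _ => c), (t : ℝ≥0∞)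

/-- `μ` is the infinite product of uniform measures on `V`: a probability measure on `ℕ → V`
under which the coordinates are independent and uniformly distributed on `V`, i.e. every
cylinder fixing the first `m` coordinates has measure `(1/|V|)^m`. -/
def IsUniformProduct {V : Type*} [Fintype V] [MeasurableSpace V]
    (μ : Measure (ℕ → V)) : Prop :=
  IsProbabilityMeasure μ ∧
    ∀ (m : ℕ) (g : ℕ → V),
      μ {ω | ∀ i < m, ω i = g i} = (1 / (Fintype.card V : ℝ≥0∞)) ^ m

/-- The `m`-th harmonic number `H_m = ∑_{i=1}^m 1/i`. -/
noncomputable def harmonic' (m : ℕ) : ℝ := ∑ i ∈ Finset.Icc 1 m, (1 : ℝ) / i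

/-! ### The dynamics started from an edge of twos -/

section Dynamics

variable {V : Type*} [Fintype V] (G : SimpleGraph V)

lemma amUpdate_le {f : V → ℕ} {c : ℕ} (hf : ∀ w, f w ≤ c) (x w : V) :
    amUpdate G f x w ≤ c := by
  unfold amUpdate
  split_ifs
  · exact Finset.sup_le fun y _ => hf y
  · exact hf w

lemma amUpdate_eq_of_adj {f : V → ℕ} {c : ℕ} (hf : ∀ w, f w ≤ c) {u v : V} (huv : G.Adj u v)
    (hu : f u = c) (hv : f v = c) (x : V) : amUpdate G f x u = c := by
  refine (amUpdate_le G hf x u).antisymm ?_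
  unfold amUpdate
  split_ifs with h
  · have hmem : v ∈ nbrs G x := by simpa [nbrs, ← h.1] using huv
    exact hv ▸ Finset.le_sup (f := f) hmem
  · exact hu.ge

lemma amRun_le {f : V → ℕ} {c : ℕ} (hf : ∀ w, f w ≤ c) (ω : ℕ → V) (t : ℕ) (w : V) :
    amRun G f ω t w ≤ c := by
  induction t generalizing w with
  | zero => exact hf w
  | succ t ih => exact amUpdate_le G ih _ w

lemma amRun_eq_of_adj {f : V → ℕ} {c : ℕ} (hf : ∀ w, f w ≤ c) {u v : V} (huv : G.Adj u v)
    (hu : f u = c) (hv : f v = c) (ω : ℕ → V) (t : ℕ) :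
    amRun G f ω t u = c ∧ amRun G f ω t v = c := by
  induction t with
  | zero => exact ⟨hu, hv⟩
  | succ t ih =>
    exact ⟨amUpdate_eq_of_adj G (amRun_le G hf ω t) huv ih.1 ih.2 _,
      amUpdate_eq_of_adj G (amRun_le G hf ω t) huv.symm ih.2 ih.1 _⟩

lemma amRun_eq_of_not_updated (f : V → ℕ) (ω : ℕ → V) (t : ℕ) (w : V) (h : ∀ i < t, ω i ≠ w) :
    amRun G f ω t w = f w := by
  induction t with
  | zero => rfl
  | succ t ih =>
    have hw : ¬ (w = ω t ∧ (nbrs G (ω t)).Nonempty) := fun h' => h t t.lt_succ_self h'.1.symm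
    rw [amRun, amUpdate, if_neg hw]
    exact ih fun i hi => h i (hi.trans t.lt_succ_self)

end Dynamics

/-! ### The coupon collector process -/

section Coupons

variable {V : Type*}

/-- The elements of `S` that do not occur in the finite sequence `g`. -/
noncomputable def missing (S : Finset V) {m : ℕ} (g : Fin m → V) : Finset V :=
  S.filter fun w => ∀ i, g i ≠ w

/-- The first `m` terms of a sequence. -/
def initSeg (m : ℕ) (ω : ℕ → V) : Fin m → V := fun i => ω i

lemma missing_zero (S : Finset V) (g : Fin 0 → V) : missing S g = S := by
  simp [missing]

lemma missing_snoc (S : Finset V) {m : ℕ} (g : Fin m → V) (x : V) :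
    missing S (Fin.snoc g x : Fin (m + 1) → V) = (missing S g).erase x := by
  ext w
  simp only [missing, Finset.mem_filter, Finset.mem_erase, Fin.forall_fin_succ', Fin.snoc_castSucc,
    Fin.snoc_last]
  tauto

lemma missing_initSeg_anti (S : Finset V) (ω : ℕ → V) {s t : ℕ} (hst : s ≤ t) :
    missing S (initSeg t ω) ⊆ missing S (initSeg s ω) := by
  intro w hw
  rw [missing, Finset.mem_filter] at hw ⊢
  exact ⟨hw.1, fun i => hw.2 (i.castLE hst)⟩

lemma measurable_initSeg [MeasurableSpace V] (m : ℕ) :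
    Measurable (initSeg m : (ℕ → V) → Fin m → V) :=
  measurable_pi_lambda _ fun i => measurable_pi_apply (i : ℕ)

variable [Fintype V]

/-- The expectation of `φ (missing S g)` for a uniformly distributed sequence `g` of length `m`. -/
noncomputable def expMissing (S : Finset V) (m : ℕ) (φ : Finset V → ℝ) : ℝ :=
  (∑ g : Fin m → V, φ (missing S g)) / (Fintype.card V : ℝ) ^ m

lemma expMissing_zero (S : Finset V) (φ : Finset V → ℝ) : expMissing S 0 φ = φ S := by
  simp [expMissing, missing_zero]

lemma expMissing_succ (S : Finset V) (m : ℕ) (φ : Finset V → ℝ) :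
    expMissing S (m + 1) φ =
      expMissing S m fun Y => (∑ x, φ (Y.erase x)) / (Fintype.card V : ℝ) := by
  have h : ∑ g : Fin (m + 1) → V, φ (missing S g) =
      ∑ g : Fin m → V, ∑ x, φ ((missing S g).erase x) := by
    rw [← (Fin.snocEquiv fun _ : Fin (m + 1) => V).sum_comp, Fintype.sum_prod_type_right]
    refine Finset.sum_congr rfl fun g _ => Finset.sum_congr rfl fun x _ => ?_
    rw [← missing_snoc]
    rfl
  rw [expMissing, expMissing, h, ← Finset.sum_div, div_div, pow_succ']

lemma expMissing_add (S : Finset V) (m : ℕ) (φ ψ : Finset V → ℝ) :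
    expMissing S m (fun Y => φ Y + ψ Y) = expMissing S m φ + expMissing S m ψ := by
  simp [expMissing, Finset.sum_add_distrib, add_div]

lemma harmonic'_succ (k : ℕ) : harmonic' (k + 1) = harmonic' k + 1 / ((k : ℝ) + 1) := by
  rw [harmonic', Finset.sum_Icc_succ_top (by omega), harmonic']
  push_cast
  rfl

lemma harmonic'_nonneg (k : ℕ) : 0 ≤ harmonic' k :=
  Finset.sum_nonneg fun _ _ => by positivity

lemma harmonic'_mono : Monotone harmonic' :=
  monotone_nat_of_le_succ fun k => by
    rw [harmonic'_succ]
    exact le_add_of_nonneg_right (by positivity)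

lemma sum_harmonic'_card_erase (Y : Finset V) :
    ∑ x, harmonic' (Y.erase x).card + (if Y.Nonempty then 1 else 0) =
      Fintype.card V * harmonic' Y.card := by
  have hx (x : V) : harmonic' (Y.erase x).card =
      harmonic' Y.card - if x ∈ Y then 1 / (Y.card : ℝ) else 0 := by
    split_ifs with h
    · rw [← Finset.card_erase_add_one h, harmonic'_succ]
      push_cast
      ring
    · rw [Finset.erase_eq_of_notMem h, sub_zero]
  simp_rw [hx, Finset.sum_sub_distrib]
  rw [Finset.sum_ite_mem, Finset.univ_inter]
  rcases Y.eq_empty_or_nonempty with rfl | hY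
  · simp
  · have : (Y.card : ℝ) ≠ 0 := by exact_mod_cast hY.card_pos.ne'
    simp [hY, this]

/-- The coupon collector identity stopped after `t` rounds. -/
lemma expMissing_harmonic' [Nonempty V] (S : Finset V) (t : ℕ) :
    expMissing S t (fun Y => Fintype.card V * harmonic' Y.card) +
      ∑ s ∈ Finset.range t, expMissing S s (fun Y => if Y.Nonempty then 1 else 0) =
    Fintype.card V * harmonic' S.card := by
  induction t with
  | zero => simp [expMissing_zero]
  | succ t ih =>
    rw [← ih, Finset.sum_range_succ, expMissing_succ, add_left_comm, ← expMissing_add,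
      add_comm]
    congr 2
    funext Y
    have : (Fintype.card V : ℝ) ≠ 0 := by exact_mod_cast Fintype.card_ne_zero
    rw [← sum_harmonic'_card_erase, ← Finset.mul_sum, mul_div_cancel_left₀ _ this]

lemma harmonic'_le_sum_expMissing [Nonempty V] (S : Finset V) (t : ℕ) :
    Fintype.card V * harmonic' S.card ≤
      ∑ s ∈ Finset.range t, expMissing S s (fun Y => if Y.Nonempty then 1 else 0) +
        Fintype.card V * harmonic' S.card *
          expMissing S t (fun Y => if Y.Nonempty then 1 else 0) := by
  refine (expMissing_harmonic' S t).ge.trans ?_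
  rw [add_comm]
  gcongr
  rw [expMissing, expMissing, ← mul_div_assoc, Finset.mul_sum]
  refine div_le_div_of_nonneg_right (Finset.sum_le_sum fun g _ => ?_) (by positivity)
  split_ifs with h
  · rw [mul_one]
    gcongr
    exact harmonic'_mono (Finset.card_le_card (Finset.filter_subset _ _))
  · simp [Finset.not_nonempty_iff_eq_empty.mp h, harmonic']

variable [MeasurableSpace V]

lemma IsUniformProduct.measure_initSeg_preimage_singleton [Nonempty V] {μ : Measure (ℕ → V)}
    (hμ : IsUniformProduct μ) {m : ℕ} (g : Fin m → V) :
    μ (initSeg m ⁻¹' {g}) = (1 / (Fintype.card V : ℝ≥0∞)) ^ m := by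
  rw [← hμ.2 m fun i => if h : i < m then g ⟨i, h⟩ else Classical.arbitrary V]
  congr 1
  ext ω
  simp only [Set.mem_preimage, Set.mem_singleton_iff, funext_iff, initSeg, Fin.forall_iff,
    Set.mem_ofPred_eq]
  exact forall₂_congr fun i hi => by rw [dif_pos hi]

variable [MeasurableSingletonClass V]

lemma IsUniformProduct.measure_missing_nonempty [Nonempty V] {μ : Measure (ℕ → V)}
    (hμ : IsUniformProduct μ) (S : Finset V) (m : ℕ) :
    μ {ω | (missing S (initSeg m ω)).Nonempty} =
      ENNReal.ofReal (expMissing S m fun Y => if Y.Nonempty then 1 else 0) := by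
  have hcard : (0 : ℝ) < Fintype.card V := by exact_mod_cast Fintype.card_pos
  have hpre : {ω : ℕ → V | (missing S (initSeg m ω)).Nonempty} =
      initSeg m ⁻¹' ((Finset.univ.filter fun g => (missing S g).Nonempty : Finset (Fin m → V)) :
        Set (Fin m → V)) := by
    ext ω
    simp
  rw [hpre, ← sum_measure_preimage_singleton _
    fun g _ => measurable_initSeg m (measurableSet_singleton g)]
  simp_rw [hμ.measure_initSeg_preimage_singleton]
  rw [expMissing, Finset.sum_boole, Finset.sum_const, nsmul_eq_mul,
    ENNReal.ofReal_div_of_pos (by positivity), ENNReal.ofReal_natCast,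
    ENNReal.ofReal_pow hcard.le, ENNReal.ofReal_natCast, one_div, ← ENNReal.inv_pow,
    div_eq_mul_inv]

lemma measurableSet_missing_nonempty (S : Finset V) (m : ℕ) :
    MeasurableSet {ω : ℕ → V | (missing S (initSeg m ω)).Nonempty} :=
  measurable_initSeg m (Set.toFinite {g | (missing S g).Nonempty}).measurableSet

/-- A random time that exceeds the coupon collector time of `S` has expectation at least
`|V| * H_{|S|}`. -/
lemma IsUniformProduct.le_lintegral_of_missing [Nonempty V] {μ : Measure (ℕ → V)}
    (hμ : IsUniformProduct μ) (S : Finset V) (T : (ℕ → V) → ℝ≥0∞)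
    (hT : ∀ ω (t : ℕ), ∑ s ∈ Finset.range t,
      {ω | (missing S (initSeg s ω)).Nonempty}.indicator (1 : (ℕ → V) → ℝ≥0∞) ω ≤ T ω) :
    ENNReal.ofReal (Fintype.card V * harmonic' S.card) ≤ ∫⁻ ω, T ω ∂μ := by
  set A : ℕ → Set (ℕ → V) := fun s => {ω | (missing S (initSeg s ω)).Nonempty} with hA
  set H := ENNReal.ofReal (Fintype.card V * harmonic' S.card) with hH
  have hsum (t : ℕ) : ∑ s ∈ Finset.range t, μ (A s) ≤ ∫⁻ ω, T ω ∂μ := by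
    calc ∑ s ∈ Finset.range t, μ (A s)
        = ∫⁻ ω, ∑ s ∈ Finset.range t, (A s).indicator (1 : (ℕ → V) → ℝ≥0∞) ω ∂μ := by
          rw [lintegral_finsetSum _ fun s _ =>
            measurable_one.indicator (measurableSet_missing_nonempty S s)]
          exact Finset.sum_congr rfl fun s _ =>
            (lintegral_indicator_one (measurableSet_missing_nonempty S s)).symm
      _ ≤ ∫⁻ ω, T ω ∂μ := lintegral_mono fun ω => hT ω t
  have hnn (s : ℕ) : 0 ≤ expMissing S s fun Y => if Y.Nonempty then 1 else 0 :=
    div_nonneg (Finset.sum_nonneg fun _ _ => by positivity) (by positivity)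
  have hHn : 0 ≤ Fintype.card V * harmonic' S.card :=
    mul_nonneg (by positivity) (harmonic'_nonneg _)
  have hstep (t : ℕ) : H ≤ ∫⁻ ω, T ω ∂μ + H * μ (A t) := by
    refine le_trans ?_ (add_le_add_left (hsum t) _)
    simp only [hA, hμ.measure_missing_nonempty]
    rw [← ENNReal.ofReal_sum_of_nonneg fun s _ => hnn s, hH, ← ENNReal.ofReal_mul hHn,
      ← ENNReal.ofReal_add (Finset.sum_nonneg fun s _ => hnn s) (mul_nonneg hHn (hnn t))]
    exact ENNReal.ofReal_le_ofReal (harmonic'_le_sum_expMissing S t)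
  rcases eq_or_ne (∫⁻ ω, T ω ∂μ) ∞ with hI | hI
  · simp [hI]
  have htsum : ∑' s, μ (A s) ≠ ∞ :=
    ne_top_of_le_ne_top hI (ENNReal.tsum_le_of_sum_range_le hsum)
  have hlim := ENNReal.tendsto_atTop_zero_of_tsum_ne_top htsum
  have hlim' := (ENNReal.Tendsto.const_mul hlim (Or.inr ENNReal.ofReal_ne_top :
    (0 : ℝ≥0∞) ≠ 0 ∨ H ≠ ∞)).const_add (∫⁻ ω, T ω ∂μ)
  rw [mul_zero, add_zero] at hlim'
  exact ge_of_tendsto' hlim' hstep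

end Coupons

/-- let `G` be a finite simple connected undirected graph on `n ≥ 3` vertices
and let `f'` assign the value `2` to two adjacent vertices and `1` to every other vertex.
Then the expected convergence time satisfies `T(G,f') ≥ n·H_{n-2}`.  In particular
`𝒯(G) = Ω(n log n)` for every connected undirected graph. -/
theorem expected_convTime_lower_bound {V : Type*} [Fintype V]
    [MeasurableSpace V] [MeasurableSingletonClass V] (n : ℕ) (hn3 : 3 ≤ n)
    (hn : Fintype.card V = n) (G : SimpleGraph V) (hG : G.Connected)
    (f' : V → ℕ) (u v : V) (huv : G.Adj u v)
    (hu : f' u = 2) (hv : f' v = 2) (hrest : ∀ w, w ≠ u → w ≠ v → f' w = 1)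
    (μ : Measure (ℕ → V)) (hμ : IsUniformProduct μ) :
    ENNReal.ofReal ((n : ℝ) * harmonic' (n - 2)) ≤ ∫⁻ ω, convTime G f' ω ∂μ := by
  have : Nonempty V := ⟨u⟩
  set S : Finset V := Finset.univ \ {u, v} with hS
  have hcard : S.card = n - 2 := by
    rw [hS, Finset.card_sdiff_of_subset (Finset.subset_univ _), Finset.card_univ, hn,
      Finset.card_pair huv.ne]
  have hle : ∀ w, f' w ≤ 2 := fun w => by
    by_cases h1 : w = u
    · exact (h1 ▸ hu).le
    by_cases h2 : w = v
    · exact (h2 ▸ hv).le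
    simp [hrest w h1 h2]
  rw [← hcard, ← hn]
  refine hμ.le_lintegral_of_missing S _ fun ω t => le_iInf₂ fun τ ⟨c, hc⟩ => ?_
  have hempty : missing S (initSeg τ ω) = ∅ := by
    refine Finset.filter_eq_empty_iff.mpr fun w hw hmiss => ?_
    simp only [hS, Finset.mem_sdiff, Finset.mem_univ, Finset.mem_insert, Finset.mem_singleton,
      true_and, not_or] at hw
    have h2 := (amRun_eq_of_adj G hle huv hu hv ω τ).1
    have h1 := amRun_eq_of_not_updated G f' ω τ w fun i hi => hmiss ⟨i, hi⟩
    rw [hrest w hw.1 hw.2] at h1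
    simp only [hc] at h1 h2
    omega
  calc _ ≤ ∑ s ∈ Finset.range t, if s < τ then (1 : ℝ≥0∞) else 0 := by
        refine Finset.sum_le_sum fun s _ => ?_
        split_ifs with h
        · exact Set.indicator_le_self' (fun _ _ => zero_le_one) ω
        · refine (Set.indicator_of_notMem (fun hω => ?_) _).le
          have hne : (missing S (initSeg τ ω)).Nonempty :=
            Finset.Nonempty.mono (missing_initSeg_anti S ω (not_lt.mp h)) hω
          simp [hempty] at hne
    _ ≤ τ := by
        rw [Finset.sum_boole]
        have hsub : (Finset.range t).filter (· < τ) ⊆ Finset.range τ := fun s hs =>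
          Finset.mem_range.mpr (Finset.mem_filter.mp hs).2
        exact_mod_cast (Finset.card_le_card hsub).trans (Finset.card_range τ).le
end

section
/- Let P_n be the undirected path graph on n ≥ 4 vertices v₁, v₂, …, v_n (with v_i adjacent to v_{i+1}), and let f' be the valuation with f'(v₁) = f'(v₂) = 2 and f'(v_i) = 1 for all i ≥ 3. Then the expected convergence time of the asynchronous maximum model satisfies T(P_n, f') = n(n−2). In particular 𝒯(P_n) ≥ n²/2, so 𝒯(P_n) = Θ(n²). -/
open MeasureTheory
open scoped ENNReal

attribute [local instance] Classical.propDecidable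

/-- The number of vertices carrying the value `2` after `t` rounds, when the process on the path
starts from the two leftmost vertices: it grows exactly when the vertex just to the right of the
block is chosen. -/
def front {n : ℕ} (ω : ℕ → Fin n) : ℕ → ℕ
  | 0 => 2
  | t + 1 => if (ω t : ℕ) = front ω t then front ω t + 1 else front ω t

theorem two_le_front {n : ℕ} (ω : ℕ → Fin n) (t : ℕ) : 2 ≤ front ω t := by
  induction t with
  | zero => simp [front]
  | succ t ih => rw [front]; split <;> omega

theorem front_le {n : ℕ} (hn : 2 ≤ n) (ω : ℕ → Fin n) (t : ℕ) : front ω t ≤ n := by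
  induction t with
  | zero => simpa [front] using hn
  | succ t ih =>
    rw [front]
    have := (ω t).isLt
    split <;> omega

theorem front_mono {n : ℕ} (ω : ℕ → Fin n) : Monotone (front ω) := by
  refine monotone_nat_of_le_succ fun t => ?_
  rw [front]
  split <;> omega

theorem front_congr {n : ℕ} {ω ω' : ℕ → Fin n} {t : ℕ} (h : ∀ i < t, ω i = ω' i) :
    front ω t = front ω' t := by
  induction t with
  | zero => rfl
  | succ t ih => rw [front, front, ih fun i hi => h i (by omega), h t (by omega)]

theorem measurable_front {n : ℕ} (t : ℕ) :
    Measurable fun ω : ℕ → Fin n => front ω t := by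
  induction t with
  | zero => exact measurable_const
  | succ t ih =>
    have hval : Measurable fun ω : ℕ → Fin n => (ω t : ℕ) :=
      (measurable_of_finite fun i : Fin n => (i : ℕ)).comp (measurable_pi_apply t)
    exact Measurable.ite (measurableSet_eq_fun hval ih) (ih.add_const 1) ih

theorem amUpdate_pathGraph_block {n k : ℕ} (hn : 2 ≤ n) (hk : 2 ≤ k) (v : Fin n) :
    amUpdate (SimpleGraph.pathGraph n) (fun i : Fin n => if (i : ℕ) < k then 2 else 1) v =
      fun i : Fin n => if (i : ℕ) < (if (v : ℕ) = k then k + 1 else k) then 2 else 1 := by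
  have hv := v.isLt
  have hmem : ∀ u, u ∈ nbrs (SimpleGraph.pathGraph n) v ↔
      (v : ℕ) + 1 = u ∨ (u : ℕ) + 1 = v := fun u => by
    simp [nbrs, SimpleGraph.pathGraph_adj]
  obtain ⟨w, hw, hwk⟩ : ∃ w ∈ nbrs (SimpleGraph.pathGraph n) v, (v : ℕ) ≤ k → (w : ℕ) < k := by
    by_cases h0 : (v : ℕ) = 0
    · exact ⟨⟨1, by omega⟩, (hmem _).2 (by simp [h0]), fun _ => by simp; omega⟩
    · exact ⟨⟨v - 1, by omega⟩, (hmem _).2 (by simp; omega), fun _ => by simp; omega⟩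
  have hsup : (nbrs (SimpleGraph.pathGraph n) v).sup
      (fun i : Fin n => if (i : ℕ) < k then 2 else 1) = if (v : ℕ) ≤ k then 2 else 1 := by
    apply le_antisymm
    · refine Finset.sup_le fun u hu => ?_
      rw [hmem] at hu
      split_ifs <;> omega
    · refine le_trans ?_ (Finset.le_sup hw)
      split_ifs <;> omega
  funext u
  rw [amUpdate, hsup]
  by_cases huv : u = v
  · subst huv
    rw [if_pos ⟨rfl, w, hw⟩]
    split_ifs <;> omega
  · have : (u : ℕ) ≠ v := fun h => huv (Fin.ext h)
    rw [if_neg fun h => huv h.1]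
    split_ifs <;> omega

theorem amRun_pathGraph {n : ℕ} (hn : 2 ≤ n) (f : Fin n → ℕ)
    (hf : ∀ i : Fin n, f i = if (i : ℕ) ≤ 1 then 2 else 1) (ω : ℕ → Fin n) (t : ℕ) :
    amRun (SimpleGraph.pathGraph n) f ω t =
      fun i : Fin n => if (i : ℕ) < front ω t then 2 else 1 := by
  induction t with
  | zero =>
    funext i
    rw [amRun, hf, front]
    split_ifs <;> omega
  | succ t ih => rw [amRun, ih, amUpdate_pathGraph_block hn (two_le_front ω t), front]

theorem amRun_pathGraph_const_iff {n : ℕ} (hn : 2 ≤ n) (f : Fin n → ℕ)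
    (hf : ∀ i : Fin n, f i = if (i : ℕ) ≤ 1 then 2 else 1) (ω : ℕ → Fin n) (t : ℕ) :
    (∃ c : ℕ, amRun (SimpleGraph.pathGraph n) f ω t = fun _ => c) ↔ ¬ front ω t < n := by
  rw [amRun_pathGraph hn f hf]
  have h2 := two_le_front ω t
  constructor
  · rintro ⟨c, hc⟩ hlt
    have h0 := congrFun hc ⟨0, by omega⟩
    have h1 := congrFun hc ⟨front ω t, hlt⟩
    simp only [lt_irrefl, if_false] at h1
    simp only [show 0 < front ω t by omega, if_true] at h0
    omega
  · intro h
    exact ⟨2, funext fun i => if_pos (by omega)⟩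

/-- The first time an upward closed property holds is the number of times it fails. -/
theorem iInf_eq_tsum_of_monotone (p : ℕ → Prop) (hp : Monotone p) :
    (⨅ (t : ℕ) (_ : p t), (t : ℝ≥0∞)) = ∑' t, if p t then 0 else 1 := by
  by_cases h : ∃ t, p t
  · have hiff : ∀ t, p t ↔ Nat.find h ≤ t :=
      fun t => ⟨Nat.find_min' h, fun ht => hp ht (Nat.find_spec h)⟩
    have hsum : (∑' t, if p t then (0 : ℝ≥0∞) else 1) = Nat.find h := by
      rw [tsum_eq_sum (s := Finset.range (Nat.find h)) fun t ht =>
        if_pos ((hiff t).2 (by simpa using ht))]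
      rw [Finset.sum_congr rfl fun t ht => if_neg fun hpt =>
        absurd ((hiff t).1 hpt) (by simpa using ht)]
      simp
    rw [hsum]
    apply le_antisymm
    · exact iInf₂_le _ (Nat.find_spec h)
    · exact le_iInf₂ fun t ht => by exact_mod_cast (hiff t).1 ht
  · push Not at h
    simp [h]

theorem convTime_pathGraph {n : ℕ} (hn : 2 ≤ n) (f : Fin n → ℕ)
    (hf : ∀ i : Fin n, f i = if (i : ℕ) ≤ 1 then 2 else 1) (ω : ℕ → Fin n) :
    convTime (SimpleGraph.pathGraph n) f ω =
      ∑' t, {ω : ℕ → Fin n | front ω t < n}.indicator 1 ω := by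
  simp only [convTime, amRun_pathGraph_const_iff hn f hf]
  rw [iInf_eq_tsum_of_monotone (fun t => ¬ front ω t < n) fun s t hst (h : ¬ _) =>
    not_lt.2 ((not_lt.1 h).trans (front_mono ω hst))]
  refine tsum_congr fun t => ?_
  by_cases h : front ω t < n <;> simp [h]

/-- Under the uniform product measure, the `t`-th coordinate hits a target that depends only on the
earlier coordinates with probability `1 / |V|`, independently of the earlier coordinates. -/
theorem IsUniformProduct.card_mul_measure_inter {V : Type*} [Fintype V] [Nonempty V]
    [MeasurableSpace V] [MeasurableSingletonClass V] {μ : Measure (ℕ → V)}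
    (hμ : IsUniformProduct μ) {t : ℕ} {A : Set (ℕ → V)} {h : (ℕ → V) → V}
    (hA : ∀ ω ω' : ℕ → V, (∀ i < t, ω i = ω' i) → ω ∈ A → ω' ∈ A)
    (hh : ∀ ω ω' : ℕ → V, (∀ i < t, ω i = ω' i) → h ω = h ω') :
    (Fintype.card V : ℝ≥0∞) * μ (A ∩ {ω | ω t = h ω}) = μ A := by
  let r : (ℕ → V) → Fin t → V := fun ω i => ω i
  have hr : Measurable r := by fun_prop
  have hsplit : ∀ B : Set (ℕ → V), μ B = ∑ p : Fin t → V, μ (r ⁻¹' {p} ∩ B) := fun B => by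
    have hm : ∀ p ∈ (Finset.univ : Finset (Fin t → V)), MeasurableSet (r ⁻¹' {p}) :=
      fun p _ => hr (measurableSet_singleton p)
    have := sum_measure_preimage_singleton (μ := μ.restrict B) Finset.univ hm
    simpa [Measure.restrict_apply (hr (measurableSet_singleton _))] using this.symm
  rw [hsplit A, hsplit, Finset.mul_sum]
  refine Finset.sum_congr rfl fun p _ => ?_
  obtain ⟨g, hg⟩ : ∃ g : ℕ → V, ∀ i : Fin t, g i = p i :=
    ⟨fun i => if hi : i < t then p ⟨i, hi⟩ else Classical.arbitrary V, fun i => by simp⟩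
  have hpre : ∀ ω, ω ∈ r ⁻¹' {p} ↔ ∀ i < t, ω i = g i := fun ω => by
    simp only [Set.mem_preimage, Set.mem_singleton_iff, funext_iff, r, ← hg]
    exact ⟨fun H i hi => H ⟨i, hi⟩, fun H i => H i i.2⟩
  by_cases hgA : g ∈ A
  · have h1 : r ⁻¹' {p} ∩ A = {ω | ∀ i < t, ω i = g i} := by
      ext ω
      rw [Set.mem_inter_iff, hpre]
      exact ⟨And.left, fun H => ⟨H, hA g ω (fun i hi => (H i hi).symm) hgA⟩⟩
    have h2 : r ⁻¹' {p} ∩ (A ∩ {ω | ω t = h ω}) =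
        {ω | ∀ i < t + 1, ω i = Function.update g t (h g) i} := by
      ext ω
      rw [← Set.inter_assoc, h1]
      simp only [Set.mem_inter_iff, Set.mem_ofPred_eq, Nat.forall_lt_succ_right,
        Function.update_self]
      have hupd : (∀ i < t, ω i = Function.update g t (h g) i) ↔ ∀ i < t, ω i = g i :=
        forall₂_congr fun i hi => by rw [Function.update_of_ne hi.ne]
      rw [hupd]
      exact and_congr_right fun H => by rw [hh ω g H]
    have hc0 : (Fintype.card V : ℝ≥0∞) ≠ 0 := by simp
    rw [h1, h2, hμ.2, hμ.2, pow_succ', ← mul_assoc, one_div,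
      ENNReal.mul_inv_cancel hc0 (ENNReal.natCast_ne_top _), one_mul]
  · have h1 : r ⁻¹' {p} ∩ A = ∅ := by
      ext ω
      rw [Set.mem_inter_iff, hpre]
      exact ⟨fun H => hgA (hA ω g H.1 H.2), False.elim⟩
    rw [← Set.inter_assoc, h1]
    simp

theorem lintegral_front_succ {n : ℕ} (hn : 2 ≤ n) {μ : Measure (ℕ → Fin n)}
    (hμ : IsUniformProduct μ) (t : ℕ) :
    (n : ℝ≥0∞) * ∫⁻ ω, front ω (t + 1) ∂μ =
      n * ∫⁻ ω, front ω t ∂μ + μ {ω | front ω t < n} := by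
  have : Nonempty (Fin n) := ⟨⟨0, by omega⟩⟩
  let h : (ℕ → Fin n) → Fin n := fun ω =>
    if hlt : front ω t < n then ⟨front ω t, hlt⟩ else Classical.arbitrary _
  have key := hμ.card_mul_measure_inter (t := t) (A := {ω | front ω t < n}) (h := h)
    (fun ω ω' H (hω : _ < n) => (front_congr H ▸ hω : front ω' t < n))
    (fun ω ω' H => by simp only [h, front_congr H])
  have hset : {ω : ℕ → Fin n | front ω t < n} ∩ {ω | ω t = h ω} =
      {ω | (ω t : ℕ) = front ω t} := by
    ext ω
    simp only [Set.mem_inter_iff, Set.mem_ofPred_eq]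
    constructor
    · rintro ⟨hlt, he⟩
      simp [he, h, hlt]
    · intro he
      have hlt : front ω t < n := he ▸ (ω t).isLt
      exact ⟨hlt, Fin.ext (by simp [h, hlt, he])⟩
  have hmeas : MeasurableSet {ω : ℕ → Fin n | (ω t : ℕ) = front ω t} :=
    measurableSet_eq_fun
      ((measurable_of_finite fun i : Fin n => (i : ℕ)).comp (measurable_pi_apply t))
      (measurable_front t)
  rw [hset, Fintype.card_fin] at key
  rw [← key, ← mul_add, ← lintegral_indicator_one hmeas,
    ← lintegral_add_right _ (measurable_one.indicator hmeas)]
  congr 2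
  funext ω
  by_cases he : (ω t : ℕ) = front ω t <;> simp [front, he]

theorem lintegral_front {n : ℕ} (hn : 2 ≤ n) {μ : Measure (ℕ → Fin n)}
    (hμ : IsUniformProduct μ) (t : ℕ) :
    (n : ℝ≥0∞) * ∫⁻ ω, front ω t ∂μ =
      n * 2 + ∑ s ∈ Finset.range t, μ {ω | front ω s < n} := by
  have := hμ.1
  induction t with
  | zero => simp [front]
  | succ t ih => rw [lintegral_front_succ hn hμ, ih, Finset.sum_range_succ, add_assoc]

theorem tsum_measure_front_lt {n : ℕ} (hn : 2 ≤ n) {μ : Measure (ℕ → Fin n)}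
    (hμ : IsUniformProduct μ) :
    (n : ℝ≥0∞) * 2 + ∑' t, μ {ω | front ω t < n} = n * n := by
  have := hμ.1
  have htend := (ENNReal.tendsto_nat_tsum fun t => μ {ω | front ω t < n}).const_add
    ((n : ℝ≥0∞) * 2)
  have hle : (n : ℝ≥0∞) * 2 + ∑' t, μ {ω | front ω t < n} ≤ n * n := by
    refine le_of_tendsto' htend fun t => ?_
    rw [← lintegral_front hn hμ]
    gcongr
    calc ∫⁻ ω, (front ω t : ℝ≥0∞) ∂μ ≤ ∫⁻ _, (n : ℝ≥0∞) ∂μ :=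
          lintegral_mono fun ω => Nat.cast_le.2 (front_le hn ω t)
      _ = n := by simp
  have hfin : ∑' t, μ {ω | front ω t < n} ≠ ∞ :=
    ((le_add_self.trans hle).trans_lt (by finiteness)).ne
  have hzero := ENNReal.tendsto_atTop_zero_of_tsum_ne_top hfin
  have htend' := htend.add
    (ENNReal.Tendsto.const_mul (a := (n * n : ℝ≥0∞)) hzero (.inr (by finiteness)))
  rw [mul_zero, add_zero] at htend'
  refine le_antisymm hle (ge_of_tendsto' htend' fun t => ?_)
  have hmeas : MeasurableSet {ω : ℕ → Fin n | front ω t < n} :=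
    measurableSet_lt (measurable_front t) measurable_const
  rw [← lintegral_front hn hμ, mul_assoc, ← mul_add, ← lintegral_indicator_one hmeas,
    ← lintegral_const_mul _ (measurable_one.indicator hmeas),
    ← lintegral_add_right _ ((measurable_one.indicator hmeas).const_mul _)]
  gcongr
  calc (n : ℝ≥0∞) = ∫⁻ _, (n : ℝ≥0∞) ∂μ := by simp
    _ ≤ _ := lintegral_mono fun ω => by
      by_cases h : front ω t < n
      · simp [h]
      · simp [(front_le hn ω t).antisymm (not_lt.1 h)]

/-- let `P_n` be the path graph on `n ≥ 4` vertices `0, 1, …, n-1` (with `i`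
adjacent to `i+1`) and let `f'` be the valuation assigning `2` to the endpoint `0` and its
neighbour `1`, and `1` to every other vertex.  Then the expected convergence time of the
asynchronous maximum model satisfies `T(P_n, f') = n(n-2)`.  In particular
`𝒯(P_n) ≥ n²/2`, so `𝒯(P_n) = Θ(n²)`. -/
theorem expected_convTime_path (n : ℕ) (hn4 : 4 ≤ n)
    (f' : Fin n → ℕ) (hf' : ∀ i : Fin n, f' i = if (i : ℕ) ≤ 1 then 2 else 1)
    (μ : Measure (ℕ → Fin n)) (hμ : IsUniformProduct μ) :
    ∫⁻ ω, convTime (SimpleGraph.pathGraph n) f' ω ∂μ = ((n * (n - 2) : ℕ) : ℝ≥0∞) := by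
  have hn : 2 ≤ n := by omega
  have hmeas : ∀ t, MeasurableSet {ω : ℕ → Fin n | front ω t < n} := fun t =>
    measurableSet_lt (measurable_front t) measurable_const
  simp only [convTime_pathGraph hn f' hf']
  rw [lintegral_tsum fun t => (measurable_one.indicator (hmeas t)).aemeasurable]
  simp only [lintegral_indicator_one (hmeas _)]
  have hfin : (n : ℝ≥0∞) * 2 ≠ ∞ := by finiteness
  refine (ENNReal.add_right_inj hfin).1 ?_
  rw [tsum_measure_front_lt hn hμ]
  obtain ⟨m, rfl⟩ := Nat.exists_eq_add_of_le' hn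
  push_cast [Nat.add_sub_cancel]
  ring
end

section
/- There exists a constant C > 0 such that for every finite simple connected undirected graph G = (V,E) on n ≥ 2 vertices with vertex expansion φ = φ(G), and every valuation f : V → {1,…,n}, the expected convergence time of the asynchronous maximum model satisfies T(G,f) ≤ C·(n/φ)·log n. In particular 𝒯(G) = O((n/φ) log n). -/
open MeasureTheory
open scoped ENNReal

attribute [local instance] Classical.propDecidable

/-- The boundary of a finset `A` in an undirected graph `G`:
the vertices outside `A` with a neighbour in `A`. -/
noncomputable def vBoundary {V : Type*} [Fintype V] (G : SimpleGraph V)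
    (A : Finset V) : Finset V :=
  Finset.univ.filter (fun v => v ∉ A ∧ ∃ u ∈ A, G.Adj u v)

/-- The vertex expansion `φ(G)`: the minimum of `|Γ(A)|/|A|` over all nonempty vertex sets `A`
with `|A| ≤ n/2`. -/
noncomputable def vertexExpansion {V : Type*} [Fintype V] (G : SimpleGraph V) : ℝ :=
  sInf {r : ℝ | ∃ A : Finset V, A.Nonempty ∧ 2 * A.card ≤ Fintype.card V ∧
    r = (vBoundary G A).card / A.card}

section Expansion

variable {V : Type*} [Fintype V] (G : SimpleGraph V)

theorem vertexExpansion_mul_card_le {A : Finset V} (hA : 2 * A.card ≤ Fintype.card V) :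
    vertexExpansion G * A.card ≤ (vBoundary G A).card := by
  rcases A.eq_empty_or_nonempty with rfl | hne
  · simp
  have hpos : (0 : ℝ) < A.card := by exact_mod_cast hne.card_pos
  rw [← le_div_iff₀ hpos]
  refine csInf_le ⟨0, ?_⟩ ⟨A, hne, hA, rfl⟩
  rintro r ⟨B, -, -, rfl⟩
  positivity

theorem vertexExpansion_le_two (hV : 2 ≤ Fintype.card V) : vertexExpansion G ≤ 2 := by
  obtain ⟨A, -, hA⟩ := Finset.exists_subset_card_eq
    (s := (Finset.univ : Finset V)) (n := Fintype.card V / 2)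
    (by rw [Finset.card_univ]; omega)
  have h := vertexExpansion_mul_card_le G (A := A) (by omega)
  have hsub : vBoundary G A ⊆ Aᶜ := by
    intro v hv
    simp only [vBoundary, Finset.mem_filter] at hv
    simpa using hv.2.1
  have hcard := Finset.card_le_card hsub
  rw [Finset.card_compl] at hcard
  have hle : (vBoundary G A).card ≤ 2 * A.card := by omega
  have hpos : (0 : ℝ) < A.card := by
    have : 0 < A.card := by omega
    exact_mod_cast this
  have hle' : ((vBoundary G A).card : ℝ) ≤ 2 * A.card := by exact_mod_cast hle
  exact le_of_mul_le_mul_right (h.trans hle') hpos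

variable {G}

theorem vBoundary_nonempty (hG : G.Connected) {A : Finset V} (hA : A.Nonempty)
    (hA' : A ≠ Finset.univ) : (vBoundary G A).Nonempty := by
  obtain ⟨a, ha⟩ := hA
  obtain ⟨b, hb⟩ : ∃ b, b ∉ A := by
    by_contra! h
    exact hA' (Finset.eq_univ_iff_forall.2 h)
  obtain ⟨p⟩ := hG.preconnected a b
  obtain ⟨d, -, h1, h2⟩ := p.exists_boundary_dart (A : Set V) ha hb
  exact ⟨d.snd, by
    simp only [vBoundary, Finset.mem_filter, Finset.mem_univ, true_and]
    exact ⟨h2, d.fst, h1, d.adj⟩⟩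

theorem vertexExpansion_pos (hG : G.Connected) (hV : 2 ≤ Fintype.card V) :
    0 < vertexExpansion G := by
  have hfin : {r : ℝ | ∃ A : Finset V, A.Nonempty ∧ 2 * A.card ≤ Fintype.card V ∧
      r = (vBoundary G A).card / A.card}.Finite :=
    (Set.finite_range fun A : Finset V => ((vBoundary G A).card / A.card : ℝ)).subset
      (by rintro r ⟨A, -, -, rfl⟩; exact ⟨A, rfl⟩)
  have : Nonempty V := hG.nonempty
  have hne : {r : ℝ | ∃ A : Finset V, A.Nonempty ∧ 2 * A.card ≤ Fintype.card V ∧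
      r = (vBoundary G A).card / A.card}.Nonempty :=
    ⟨_, {Classical.arbitrary V}, Finset.singleton_nonempty _, by simpa using hV, rfl⟩
  obtain ⟨A, hA, hcard, hr⟩ := hne.csInf_mem hfin
  rw [vertexExpansion, hr]
  have hb : 0 < (vBoundary G A).card := by
    refine (vBoundary_nonempty hG hA ?_).card_pos
    rintro rfl
    rw [Finset.card_univ] at hcard
    omega
  have := hA.card_pos
  positivity

theorem vertexExpansion_mul_card_compl_le (hV : 2 ≤ Fintype.card V) {A : Finset V}
    (hA : Fintype.card V < 2 * A.card) :
    vertexExpansion G * (Fintype.card V - A.card) ≤ 3 * (vBoundary G A).card := by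
  have hsub : vBoundary G A ⊆ Aᶜ := by
    intro v hv
    simp only [vBoundary, Finset.mem_filter] at hv
    simpa using hv.2.1
  have hle := A.card_le_univ
  have hcard : (Aᶜ \ vBoundary G A).card + (vBoundary G A).card = Fintype.card V - A.card := by
    rw [Finset.card_sdiff_add_card_eq_card hsub, Finset.card_compl]
  have hint : vBoundary G (Aᶜ \ vBoundary G A) ⊆ vBoundary G A := by
    intro v hv
    simp only [vBoundary, Finset.mem_filter, Finset.mem_univ, true_and, Finset.mem_sdiff,
      Finset.mem_compl] at hv ⊢
    obtain ⟨hv, u, ⟨huA, hu⟩, huv⟩ := hv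
    by_cases hvA : v ∈ A
    · exact absurd ⟨huA, v, hvA, huv.symm⟩ hu
    · by_contra h
      exact hv ⟨hvA, h⟩
  have h := vertexExpansion_mul_card_le G (A := Aᶜ \ vBoundary G A) (by omega)
  have h2 : ((vBoundary G (Aᶜ \ vBoundary G A)).card : ℝ) ≤ (vBoundary G A).card := by
    exact_mod_cast Finset.card_le_card hint
  have h3 : ((Aᶜ \ vBoundary G A).card : ℝ) + (vBoundary G A).card
      = Fintype.card V - A.card := by
    rw [← Nat.cast_sub hle]
    exact_mod_cast hcard
  have h4 : vertexExpansion G * (vBoundary G A).card ≤ 2 * (vBoundary G A).card :=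
    mul_le_mul_of_nonneg_right (vertexExpansion_le_two G hV) (Nat.cast_nonneg _)
  rw [← h3]
  linarith

end Expansion

section SetProcess

variable {V : Type*} (G : SimpleGraph V)

/-- The update at `w` seen on a superlevel set `A` of the valuation: `w` belongs to the new set
iff it has a neighbour in `A`. -/
noncomputable def setUpdate (A : Finset V) (w : V) : Finset V :=
  if ∃ x ∈ A, G.Adj w x then insert w A else A.erase w

/-- The superlevel set `A` after `t` rounds of the update sequence `ω`. -/
noncomputable def setRun (A : Finset V) (ω : ℕ → V) : ℕ → Finset V
  | 0 => A
  | (t + 1) => setUpdate G (setRun A ω t) (ω t)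

theorem setRun_congr (A : Finset V) {ω ω' : ℕ → V} {t : ℕ} (h : ∀ i < t, ω i = ω' i) :
    setRun G A ω t = setRun G A ω' t := by
  induction t with
  | zero => rfl
  | succ t ih =>
    simp only [setRun]
    rw [ih fun i hi => h i (by omega), h t (by omega)]

/-- `A` has at most one element, or no isolated vertices. -/
def NoIsolated (A : Finset V) : Prop :=
  A.card ≤ 1 ∨ ∀ u ∈ A, ∃ x ∈ A, G.Adj u x

variable {G}

theorem mem_setUpdate_self {A : Finset V} {w : V} :
    w ∈ setUpdate G A w ↔ ∃ x ∈ A, G.Adj w x := by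
  unfold setUpdate
  split_ifs with h <;> simp [h]

theorem mem_setUpdate_of_ne {A : Finset V} {w u : V} (h : u ≠ w) :
    u ∈ setUpdate G A w ↔ u ∈ A := by
  unfold setUpdate
  split_ifs <;> simp [h]

variable [Fintype V]

theorem mem_vBoundary {A : Finset V} {w : V} :
    w ∈ vBoundary G A ↔ w ∉ A ∧ ∃ x ∈ A, G.Adj w x := by
  simp [vBoundary, G.adj_comm]

theorem setUpdate_of_mem_vBoundary {A : Finset V} {w : V} (hw : w ∈ vBoundary G A) :
    setUpdate G A w = insert w A :=
  if_pos (mem_vBoundary.1 hw).2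

theorem NoIsolated.setUpdate_of_notMem_vBoundary {A : Finset V} (hA : NoIsolated G A) {w : V}
    (hw : w ∉ vBoundary G A) : setUpdate G A w = A ∨ setUpdate G A w = ∅ := by
  rw [mem_vBoundary] at hw
  unfold setUpdate
  split_ifs with h
  · left
    refine Finset.insert_eq_of_mem ?_
    by_contra hwA
    exact hw ⟨hwA, h⟩
  · by_cases hwA : w ∈ A
    · right
      rcases hA with hA | hA
      · rw [← Finset.card_eq_zero, Finset.card_erase_of_mem hwA]
        omega
      · exact absurd (hA w hwA) h
    · exact Or.inl (Finset.erase_eq_of_notMem hwA)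

theorem NoIsolated.setUpdate {A : Finset V} (hA : NoIsolated G A) (w : V) :
    NoIsolated G (setUpdate G A w) := by
  by_cases hw : w ∈ vBoundary G A
  · rw [setUpdate_of_mem_vBoundary hw]
    obtain ⟨hwA, x, hx, hadj⟩ := mem_vBoundary.1 hw
    right
    intro u hu
    rcases Finset.mem_insert.1 hu with rfl | hu
    · exact ⟨x, Finset.mem_insert_of_mem hx, hadj⟩
    · rcases hA with hA | hA
      · obtain rfl := Finset.card_le_one.1 hA u hu x hx
        exact ⟨w, Finset.mem_insert_self _ _, hadj.symm⟩
      · obtain ⟨y, hy, h⟩ := hA u hu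
        exact ⟨y, Finset.mem_insert_of_mem hy, h⟩
  · rcases hA.setUpdate_of_notMem_vBoundary hw with h | h
    · rwa [h]
    · rw [h]
      exact Or.inl (by simp)

theorem noIsolated_setRun_singleton (v : V) (ω : ℕ → V) (t : ℕ) :
    NoIsolated G (setRun G {v} ω t) := by
  induction t with
  | zero => exact Or.inl (by simp [setRun])
  | succ t ih => exact ih.setUpdate _

theorem nbrs_nonempty (hG : G.Connected) (hV : 2 ≤ Fintype.card V) (v : V) :
    (nbrs G v).Nonempty := by
  have : Nontrivial V := Fintype.one_lt_card_iff_nontrivial.1 hV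
  obtain ⟨u, hu⟩ := hG.preconnected.exists_adj_of_nontrivial v
  exact ⟨u, by simpa [nbrs] using hu⟩

theorem le_amRun_iff (hG : G.Connected) (hV : 2 ≤ Fintype.card V) (f : V → ℕ) (ω : ℕ → V)
    (t : ℕ) {k : ℕ} (hk : 0 < k) (u : V) :
    k ≤ amRun G f ω t u ↔ ∃ v, k ≤ f v ∧ u ∈ setRun G {v} ω t := by
  induction t generalizing u with
  | zero => simp [amRun, setRun]
  | succ t ih =>
    simp only [amRun, setRun, amUpdate]
    by_cases hu : u = ω t
    · subst hu
      rw [if_pos ⟨rfl, nbrs_nonempty hG hV _⟩, Finset.le_sup_iff hk]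
      simp only [ih, mem_setUpdate_self, nbrs, Finset.mem_filter, Finset.mem_univ, true_and]
      tauto
    · rw [if_neg fun h => hu h.1, ih]
      simp only [mem_setUpdate_of_ne hu]

theorem amRun_constant (hG : G.Connected) (hV : 2 ≤ Fintype.card V) (f : V → ℕ) (ω : ℕ → V)
    (t : ℕ) (h : ∀ v, setRun G {v} ω t = ∅ ∨ setRun G {v} ω t = Finset.univ) :
    ∃ c : ℕ, amRun G f ω t = fun _ => c := by
  have : Nonempty V := hG.nonempty
  have hle : ∀ u u', amRun G f ω t u ≤ amRun G f ω t u' := by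
    intro u u'
    rcases Nat.eq_zero_or_pos (amRun G f ω t u) with h0 | h0
    · omega
    · obtain ⟨v, hv, huv⟩ := (le_amRun_iff hG hV f ω t h0 u).1 le_rfl
      refine (le_amRun_iff hG hV f ω t h0 u').2 ⟨v, hv, ?_⟩
      rcases h v with h | h
      · simp [h] at huv
      · simp [h]
  exact ⟨amRun G f ω t (Classical.arbitrary V), funext fun u => le_antisymm (hle _ _) (hle _ _)⟩

/-- The potential `n / |A| - 1`, truncated to vanish at `A = ∅`. -/
noncomputable def setPotential (A : Finset V) : ℝ≥0∞ :=
  ENNReal.ofReal ((Fintype.card V : ℝ) / A.card - 1)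

@[simp]
theorem setPotential_empty : setPotential (∅ : Finset V) = 0 := by
  simp [setPotential]

theorem setPotential_singleton_le (v : V) :
    setPotential ({v} : Finset V) ≤ ENNReal.ofReal (Fintype.card V) := by
  refine ENNReal.ofReal_le_ofReal ?_
  simp

theorem one_le_card_mul_setPotential {A : Finset V} (h : A ≠ ∅) (h' : A ≠ Finset.univ) :
    1 ≤ ENNReal.ofReal (Fintype.card V) * setPotential A := by
  have h0 : 0 < A.card := (Finset.nonempty_iff_ne_empty.2 h).card_pos
  have h1 : A.card + 1 ≤ Fintype.card V := Finset.card_lt_univ_of_notMem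
    (x := (Classical.not_forall.1 fun h => h' (Finset.eq_univ_iff_forall.2 h)).choose)
    (Classical.not_forall.1 fun h => h' (Finset.eq_univ_iff_forall.2 h)).choose_spec
  rw [setPotential, ← ENNReal.ofReal_mul (by positivity), ← ENNReal.ofReal_one]
  refine ENNReal.ofReal_le_ofReal ?_
  have h0' : (0 : ℝ) < A.card := by exact_mod_cast h0
  have h1' : (A.card : ℝ) + 1 ≤ Fintype.card V := by exact_mod_cast h1
  rw [div_sub_one h0'.ne', ← mul_div_assoc, le_div_iff₀ h0']
  nlinarith

theorem vertexExpansion_mul_le_card_vBoundary (hG : G.Connected) (hV : 2 ≤ Fintype.card V)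
    {A : Finset V} (hA : A.Nonempty) (hA' : A.card < Fintype.card V) :
    vertexExpansion G * ((Fintype.card V - A.card) * (A.card + 1)) ≤
      3 * (vBoundary G A).card * Fintype.card V := by
  have hφ := (vertexExpansion_pos hG hV).le
  have h0 : (1 : ℝ) ≤ A.card := by exact_mod_cast hA.card_pos
  have h1 : (A.card : ℝ) + 1 ≤ Fintype.card V := by exact_mod_cast hA'
  rcases le_or_gt (2 * A.card) (Fintype.card V) with h | h
  · have := vertexExpansion_mul_card_le G h
    calc vertexExpansion G * ((Fintype.card V - A.card) * (A.card + 1))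
        ≤ vertexExpansion G * (Fintype.card V * (3 * A.card)) := by
          gcongr <;> linarith
      _ = 3 * (vertexExpansion G * A.card) * Fintype.card V := by ring
      _ ≤ _ := by gcongr
  · have := vertexExpansion_mul_card_compl_le (G := G) hV h
    rw [← mul_assoc]
    gcongr

theorem sum_setPotential_setUpdate_le (hG : G.Connected) (hV : 2 ≤ Fintype.card V)
    {A : Finset V} (hA : NoIsolated G A) :
    ∑ w, setPotential (setUpdate G A w) ≤
      ENNReal.ofReal (Fintype.card V - vertexExpansion G / 3) * setPotential A := by
  have hφ2 := vertexExpansion_le_two G hV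
  have hV' : (2 : ℝ) ≤ Fintype.card V := by exact_mod_cast hV
  rcases A.eq_empty_or_nonempty with rfl | hne
  · have : ∀ w, setUpdate G ∅ w = ∅ := by simp [setUpdate]
    simp [this]
  set n : ℝ := (Fintype.card V : ℝ) with hn
  set k : ℝ := (A.card : ℝ) with hk
  have hk1 : 1 ≤ k := by rw [hk]; exact_mod_cast hne.card_pos
  have hkn : k ≤ n := by rw [hk, hn]; exact_mod_cast A.card_le_univ
  have hgk : 0 ≤ n / k - 1 := by
    rw [sub_nonneg, le_div_iff₀ (by linarith)]; linarith
  have hsucc : ∀ w ∈ vBoundary G A, A.card + 1 ≤ Fintype.card V := fun w hw =>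
    Finset.card_lt_univ_of_notMem (mem_vBoundary.1 hw).1
  let c : V → ℝ := fun w => if w ∈ vBoundary G A then n / (k + 1) - 1 else n / k - 1
  have hc : ∀ w, 0 ≤ c w := by
    intro w
    simp only [c]
    split_ifs with hw
    · rw [sub_nonneg, le_div_iff₀ (by linarith), one_mul]
      rw [hk, hn]
      exact_mod_cast hsucc w hw
    · exact hgk
  have hle : ∀ w, setPotential (setUpdate G A w) ≤ ENNReal.ofReal (c w) := by
    intro w
    simp only [c]
    split_ifs with hw
    · rw [setUpdate_of_mem_vBoundary hw, setPotential,
        Finset.card_insert_of_notMem (mem_vBoundary.1 hw).1, Nat.cast_succ]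
    · rcases hA.setUpdate_of_notMem_vBoundary hw with h | h
      · rw [h, setPotential]
      · rw [h, setPotential_empty]; exact zero_le
  calc ∑ w, setPotential (setUpdate G A w) ≤ ∑ w, ENNReal.ofReal (c w) :=
        Finset.sum_le_sum fun w _ => hle w
    _ = ENNReal.ofReal (∑ w, c w) := (ENNReal.ofReal_sum_of_nonneg fun w _ => hc w).symm
    _ ≤ ENNReal.ofReal ((n - vertexExpansion G / 3) * (n / k - 1)) := by
        refine ENNReal.ofReal_le_ofReal ?_
        have hsum : ∑ w, c w
            = n * (n / k - 1) - (vBoundary G A).card * (n / k - n / (k + 1)) := by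
          have : ∀ w, c w = (n / k - 1) -
              if w ∈ vBoundary G A then (n / k - n / (k + 1)) else 0 := by
            intro w
            simp only [c]
            split_ifs <;> ring
          simp only [this, Finset.sum_sub_distrib, Finset.sum_const, Finset.card_univ,
            nsmul_eq_mul, Finset.sum_ite_mem, Finset.univ_inter, ← hn]
          ring
        rw [hsum]
        have hkey : vertexExpansion G / 3 * (n / k - 1)
            ≤ (vBoundary G A).card * (n / k - n / (k + 1)) := by
          rcases A.card_le_univ.lt_or_eq with hlt | heq
          · have h := vertexExpansion_mul_le_card_vBoundary hG hV hne hlt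
            rw [← hn, ← hk] at h
            have e1 : vertexExpansion G / 3 * (n / k - 1)
                = vertexExpansion G * ((n - k) * (k + 1)) / (3 * k * (k + 1)) := by
              field_simp
            have e2 : ((vBoundary G A).card : ℝ) * (n / k - n / (k + 1))
                = 3 * (vBoundary G A).card * n / (3 * k * (k + 1)) := by
              field_simp
              ring
            rw [e1, e2]
            gcongr
          · have : n = k := by rw [hn, hk, heq]
            have h0 : n / k - 1 = 0 := by
              rw [this, div_self (by linarith), sub_self]
            rw [h0, mul_zero]
            refine mul_nonneg (Nat.cast_nonneg _) (sub_nonneg.2 ?_)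
            gcongr
            linarith
        linarith
    _ = _ := by rw [ENNReal.ofReal_mul (by linarith), setPotential]

theorem convTime_le_tsum (f : V → ℕ) (ω : ℕ → V) :
    convTime G f ω ≤
      ∑' t : ℕ, if ∃ c : ℕ, amRun G f ω t = fun _ => c then 0 else 1 := by
  by_cases h : ∃ t, ∃ c : ℕ, amRun G f ω t = fun _ => c
  · calc convTime G f ω ≤ (Nat.find h : ℝ≥0∞) := by
          unfold convTime
          exact iInf₂_le (Nat.find h) (Nat.find_spec h)
      _ = ∑ t ∈ Finset.range (Nat.find h), (1 : ℝ≥0∞) := by simp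
      _ = ∑ t ∈ Finset.range (Nat.find h),
          if ∃ c : ℕ, amRun G f ω t = fun _ => c then (0 : ℝ≥0∞) else 1 :=
        Finset.sum_congr rfl fun t ht =>
          (if_neg (Nat.find_min h (Finset.mem_range.1 ht))).symm
      _ ≤ _ := ENNReal.sum_le_tsum _
  · have : ∀ t, ¬ ∃ c : ℕ, amRun G f ω t = fun _ => c := fun t ht => h ⟨t, ht⟩
    simp [this]

theorem notConstant_indicator_le (hG : G.Connected) (hV : 2 ≤ Fintype.card V) (f : V → ℕ)
    (ω : ℕ → V) (t : ℕ) :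
    (if ∃ c : ℕ, amRun G f ω t = fun _ => c then 0 else 1 : ℝ≥0∞) ≤
      min 1 (ENNReal.ofReal (Fintype.card V) * ∑ v, setPotential (setRun G {v} ω t)) := by
  split_ifs with h
  · exact zero_le
  · refine le_min le_rfl ?_
    obtain ⟨v, hv⟩ := not_forall.1 fun h' => h (amRun_constant hG hV f ω t h')
    rw [not_or] at hv
    refine (one_le_card_mul_setPotential hv.1 hv.2).trans ?_
    gcongr
    exact Finset.single_le_sum (f := fun v => setPotential (setRun G {v} ω t))
      (fun _ _ => zero_le) (Finset.mem_univ v)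

end SetProcess

/-- The sequence extending a finite word by a constant letter. -/
def extendWord {V : Type*} (d : V) {m : ℕ} (g : Fin m → V) (i : ℕ) : V :=
  if h : i < m then g ⟨i, h⟩ else d

theorem eq_comp_extendWord {V E : Type*} (d : V) {m : ℕ} {F : (ℕ → V) → E}
    (hF : ∀ ω ω', (∀ i < m, ω i = ω' i) → F ω = F ω') :
    F = (fun g : Fin m → V => F (extendWord d g)) ∘ fun ω i => ω i := by
  funext ω
  refine hF _ _ fun i hi => ?_
  simp [extendWord, hi]

section UniformProduct

variable {V : Type*} [Fintype V] [MeasurableSpace V] [MeasurableSingletonClass V]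

variable {μ : Measure (ℕ → V)} {E : Type*}

theorem measurable_of_initial_coords [Nonempty V] [MeasurableSpace E] {m : ℕ} {F : (ℕ → V) → E}
    (hF : ∀ ω ω', (∀ i < m, ω i = ω' i) → F ω = F ω') : Measurable F := by
  rw [eq_comp_extendWord (Classical.arbitrary V) hF]
  exact (measurable_of_finite _).comp (by fun_prop)

theorem IsUniformProduct.lintegral_eq_sum_words (hμ : IsUniformProduct μ) (d : V) {m : ℕ}
    {F : (ℕ → V) → ℝ≥0∞} (hF : ∀ ω ω', (∀ i < m, ω i = ω' i) → F ω = F ω') :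
    ∫⁻ ω, F ω ∂μ =
      (1 / (Fintype.card V : ℝ≥0∞)) ^ m * ∑ g : Fin m → V, F (extendWord d g) := by
  have hr : Measurable fun (ω : ℕ → V) (i : Fin m) => ω i := by fun_prop
  have e : ∫⁻ ω, F ω ∂μ = ∫⁻ g, F (extendWord d g)
      ∂(μ.map fun (ω : ℕ → V) (i : Fin m) => ω i) := by
    rw [lintegral_map (measurable_of_finite _) hr]
    exact lintegral_congr fun ω => congrFun (eq_comp_extendWord d hF) ω
  rw [e, lintegral_fintype, Finset.mul_sum]
  refine Finset.sum_congr rfl fun g _ => ?_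
  rw [mul_comm, Measure.map_apply hr (measurableSet_singleton g), ← hμ.2 m (extendWord d g)]
  congr 2
  ext ω
  simp only [Set.mem_preimage, Set.mem_singleton_iff, Set.mem_ofPred_eq, funext_iff, extendWord]
  constructor
  · intro h i hi
    simpa [hi] using h ⟨i, hi⟩
  · intro h i
    simpa using h i i.2

theorem IsUniformProduct.lintegral_apply_coord [Nonempty V] (hμ : IsUniformProduct μ) {t : ℕ}
    {H : (ℕ → V) → V → ℝ≥0∞} (hH : ∀ ω ω', (∀ i < t, ω i = ω' i) → H ω = H ω') :
    ∫⁻ ω, H ω (ω t) ∂μ = 1 / (Fintype.card V : ℝ≥0∞) * ∫⁻ ω, ∑ w, H ω w ∂μ := by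
  have d : V := Classical.arbitrary V
  rw [hμ.lintegral_eq_sum_words d (m := t + 1) (F := fun ω => H ω (ω t)) ?_,
    hμ.lintegral_eq_sum_words d (m := t) (F := fun ω => ∑ w, H ω w) ?_, pow_succ', mul_assoc]
  · congr 2
    rw [← (Fin.snocEquiv fun _ : Fin (t + 1) => V).sum_comp, Fintype.sum_prod_type,
      Finset.sum_comm]
    refine Finset.sum_congr rfl fun g _ => Finset.sum_congr rfl fun w _ => ?_
    have h1 : H (extendWord d (Fin.snoc (α := fun _ => V) g w)) = H (extendWord d g) := by
      refine hH _ _ fun i hi => ?_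
      simp [extendWord, hi, Nat.lt_succ_of_lt hi, Fin.snoc]
    have h2 : extendWord d (Fin.snoc (α := fun _ => V) g w) t = w := by
      simp [extendWord, Fin.snoc]
    change H (extendWord d (Fin.snoc (α := fun _ => V) g w))
      (extendWord d (Fin.snoc (α := fun _ => V) g w) t) = _
    rw [h1, h2]
  · intro ω ω' h
    simp only [hH ω ω' h]
  · intro ω ω' h
    simp only [hH ω ω' fun i hi => h i (by omega), h t (by omega)]

variable {G : SimpleGraph V}

theorem IsUniformProduct.lintegral_setPotential_le (hμ : IsUniformProduct μ)
    (hG : G.Connected) (hV : 2 ≤ Fintype.card V) (v : V) (t : ℕ) :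
    ∫⁻ ω, setPotential (setRun G {v} ω t) ∂μ ≤
      ENNReal.ofReal (1 - vertexExpansion G / (3 * Fintype.card V)) ^ t *
        ENNReal.ofReal (Fintype.card V) := by
  have : Nonempty V := ⟨v⟩
  have := hμ.1
  induction t with
  | zero => simpa [setRun] using setPotential_singleton_le v
  | succ t ih =>
    have hn : (0 : ℝ) < Fintype.card V := by
      have : 0 < Fintype.card V := by omega
      exact_mod_cast this
    have hpre : ∀ ω ω' : ℕ → V, (∀ i < t, ω i = ω' i) →
        setRun G {v} ω t = setRun G {v} ω' t := fun ω ω' h => setRun_congr G {v} h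
    have hstep := hμ.lintegral_apply_coord (t := t)
      (H := fun ω w => setPotential (setUpdate G (setRun G {v} ω t) w))
      (fun ω ω' h => by simp only [hpre ω ω' h])
    simp only [setRun]
    rw [hstep]
    calc 1 / (Fintype.card V : ℝ≥0∞) *
          ∫⁻ ω, ∑ w, setPotential (setUpdate G (setRun G {v} ω t) w) ∂μ
        ≤ 1 / (Fintype.card V : ℝ≥0∞) *
          ∫⁻ ω, ENNReal.ofReal (Fintype.card V - vertexExpansion G / 3) *
            setPotential (setRun G {v} ω t) ∂μ := by
          gcongr with ω
          exact sum_setPotential_setUpdate_le hG hV (noIsolated_setRun_singleton v ω t)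
      _ = ENNReal.ofReal (1 - vertexExpansion G / (3 * Fintype.card V)) *
          ∫⁻ ω, setPotential (setRun G {v} ω t) ∂μ := by
          rw [lintegral_const_mul _ (measurable_of_initial_coords (m := t) fun ω ω' h => by
            rw [hpre ω ω' h]), ← mul_assoc]
          congr 1
          rw [← ENNReal.ofReal_natCast, ← ENNReal.ofReal_one, ← ENNReal.ofReal_div_of_pos hn,
            ← ENNReal.ofReal_mul (by positivity)]
          congr 1
          field_simp
      _ ≤ _ := by
          rw [pow_succ', mul_assoc]
          gcongr

theorem IsUniformProduct.lintegral_convTime_le_tsum (hμ : IsUniformProduct μ)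
    (hG : G.Connected) (hV : 2 ≤ Fintype.card V) (f : V → ℕ) :
    ∫⁻ ω, convTime G f ω ∂μ ≤
      ∑' t : ℕ, min 1 (ENNReal.ofReal ((Fintype.card V : ℝ) ^ 3) *
        ENNReal.ofReal (1 - vertexExpansion G / (3 * Fintype.card V)) ^ t) := by
  have : Nonempty V := hG.nonempty
  have := hμ.1
  have hpre : ∀ (t : ℕ) (v : V) (ω ω' : ℕ → V), (∀ i < t, ω i = ω' i) →
      setPotential (setRun G {v} ω t) = setPotential (setRun G {v} ω' t) :=
    fun t v ω ω' h => by rw [setRun_congr G {v} h]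
  have hmeas : ∀ t v, Measurable fun ω => setPotential (setRun G {v} ω t) :=
    fun t v => measurable_of_initial_coords (hpre t v)
  calc ∫⁻ ω, convTime G f ω ∂μ
      ≤ ∫⁻ ω, ∑' t : ℕ, min 1
          (ENNReal.ofReal (Fintype.card V) * ∑ v, setPotential (setRun G {v} ω t)) ∂μ :=
        lintegral_mono fun ω => (convTime_le_tsum f ω).trans
          (ENNReal.tsum_le_tsum fun t => notConstant_indicator_le hG hV f ω t)
    _ = ∑' t : ℕ, ∫⁻ ω, min 1
          (ENNReal.ofReal (Fintype.card V) * ∑ v, setPotential (setRun G {v} ω t)) ∂μ :=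
        lintegral_tsum fun t => (measurable_const.min
          ((Finset.measurable_fun_sum _ fun v _ => hmeas t v).const_mul _)).aemeasurable
    _ ≤ _ := by
        refine ENNReal.tsum_le_tsum fun t => le_min ?_ ?_
        · calc _ ≤ ∫⁻ _, 1 ∂μ := lintegral_mono fun ω => min_le_left _ _
            _ = 1 := by simp
        · calc _ ≤ ∫⁻ ω, ENNReal.ofReal (Fintype.card V) *
                ∑ v, setPotential (setRun G {v} ω t) ∂μ :=
                lintegral_mono fun ω => min_le_right _ _
            _ = ENNReal.ofReal (Fintype.card V) *
                ∑ v, ∫⁻ ω, setPotential (setRun G {v} ω t) ∂μ := by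
                rw [lintegral_const_mul _ (by fun_prop), lintegral_finsetSum _
                  fun v _ => hmeas t v]
            _ ≤ ENNReal.ofReal (Fintype.card V) * ∑ _v : V,
                ENNReal.ofReal (1 - vertexExpansion G / (3 * Fintype.card V)) ^ t *
                  ENNReal.ofReal (Fintype.card V) := by
                gcongr with v
                exact hμ.lintegral_setPotential_le hG hV v t
            _ = _ := by
                rw [Finset.sum_const, Finset.card_univ, nsmul_eq_mul, pow_three,
                  ENNReal.ofReal_mul (by positivity), ENNReal.ofReal_mul (by positivity),
                  ENNReal.ofReal_natCast]
                ring

end UniformProduct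

theorem tsum_min_one_geometric_le {δ K : ℝ} (hδ : 0 < δ) (hδ1 : δ ≤ 1) (hK : 1 ≤ K) :
    ∑' t : ℕ, min 1 (ENNReal.ofReal K * ENNReal.ofReal (1 - δ) ^ t) ≤
      ENNReal.ofReal ((Real.log K + 2) / δ) := by
  have hlog : 0 ≤ Real.log K / δ := div_nonneg (Real.log_nonneg hK) hδ.le
  set t₀ := ⌈Real.log K / δ⌉₊ with ht₀
  have hsmall : K * (1 - δ) ^ t₀ ≤ 1 := by
    have h1 : (1 - δ) ^ t₀ ≤ Real.exp (-Real.log K) := by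
      calc (1 - δ) ^ t₀ ≤ Real.exp (-δ) ^ t₀ :=
            pow_le_pow_left₀ (by linarith) (Real.one_sub_le_exp_neg δ) _
        _ = Real.exp (t₀ * -δ) := (Real.exp_nat_mul _ _).symm
        _ ≤ _ := by
            rw [Real.exp_le_exp, mul_neg, neg_le_neg_iff, ← div_le_iff₀ hδ]
            exact Nat.le_ceil _
    rw [Real.exp_neg, Real.exp_log (by linarith)] at h1
    calc K * (1 - δ) ^ t₀ ≤ K * K⁻¹ := by gcongr
      _ = 1 := mul_inv_cancel₀ (by linarith)
  rw [← Summable.sum_add_tsum_nat_add' (f := fun t : ℕ =>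
    min 1 (ENNReal.ofReal K * ENNReal.ofReal (1 - δ) ^ t)) (k := t₀) ENNReal.summable]
  have hhead : ∑ t ∈ Finset.range t₀, min 1 (ENNReal.ofReal K * ENNReal.ofReal (1 - δ) ^ t) ≤
      ENNReal.ofReal t₀ := by
    calc _ ≤ ∑ t ∈ Finset.range t₀, (1 : ℝ≥0∞) :=
          Finset.sum_le_sum fun t _ => min_le_left _ _
      _ = _ := by simp
  have htail : ∑' t : ℕ, min 1 (ENNReal.ofReal K * ENNReal.ofReal (1 - δ) ^ (t + t₀)) ≤
      ENNReal.ofReal (1 / δ) := by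
    calc _ ≤ ∑' t : ℕ, ENNReal.ofReal (1 - δ) ^ t := by
          refine ENNReal.tsum_le_tsum fun t => (min_le_right _ _).trans ?_
          rw [pow_add, mul_left_comm, ← ENNReal.ofReal_pow (n := t₀) (by linarith),
            ← ENNReal.ofReal_mul (by linarith)]
          exact mul_le_of_le_one_right' (ENNReal.ofReal_le_one.2 hsmall)
      _ = _ := by
          rw [ENNReal.tsum_geometric, ← ENNReal.ofReal_one,
            ← ENNReal.ofReal_sub _ (by linarith), sub_sub_cancel, one_div,
            ENNReal.ofReal_inv_of_pos hδ]
  refine (add_le_add hhead htail).trans ?_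
  rw [← ENNReal.ofReal_add (Nat.cast_nonneg _) (by positivity)]
  refine ENNReal.ofReal_le_ofReal ?_
  have h1 : (t₀ : ℝ) ≤ Real.log K / δ + 1 := (Nat.ceil_lt_add_one hlog).le
  have h2 : 1 ≤ 1 / δ := by rwa [one_le_div hδ]
  rw [add_div, show (2 : ℝ) / δ = 1 / δ + 1 / δ by ring]
  linarith

/-- there is a constant `C > 0` such that for every finite simple connected
undirected graph `G` on `n ≥ 2` vertices with vertex expansion `φ` and every valuation
`f : V → {1,…,n}`, the expected convergence time of the asynchronous maximum model satisfies
`T(G,f) ≤ C·(n/φ)·log n`.  In particular `𝒯(G) = O((n/φ) log n)`. -/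
theorem expected_convTime_le_expansion :
    ∃ C : ℝ, 0 < C ∧
      ∀ (V : Type) [Fintype V] [MeasurableSpace V] [MeasurableSingletonClass V]
        (n : ℕ), 2 ≤ n → Fintype.card V = n →
        ∀ (G : SimpleGraph V), G.Connected →
        ∀ (f : V → ℕ), (∀ v, f v ∈ Finset.Icc 1 n) →
        ∀ (μ : Measure (ℕ → V)), IsUniformProduct μ →
          ∫⁻ ω, convTime G f ω ∂μ ≤
            ENNReal.ofReal (C * ((n : ℝ) / vertexExpansion G) * Real.log n) := by
  refine ⟨18, by norm_num, ?_⟩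
  intro V _ _ _ n hn hcard G hG f _ μ hμ
  subst hcard
  have hφ := vertexExpansion_pos hG hn
  have hφ2 := vertexExpansion_le_two G hn
  have hn' : (2 : ℝ) ≤ Fintype.card V := by exact_mod_cast hn
  refine (hμ.lintegral_convTime_le_tsum hG hn f).trans
    ((tsum_min_one_geometric_le (by positivity) ?_ (one_le_pow₀ (by linarith))).trans
      (ENNReal.ofReal_le_ofReal ?_))
  · rw [div_le_one (by positivity)]
    linarith
  · have hlog : Real.log 2 ≤ Real.log (Fintype.card V) := Real.log_le_log (by norm_num) hn'
    have hlog2 := Real.log_two_gt_d9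
    rw [Real.log_pow, div_div_eq_mul_div, mul_div_assoc', div_mul_eq_mul_div]
    refine div_le_div_of_nonneg_right ?_ hφ.le
    push_cast
    nlinarith
end

section
/- Let G = (V,E) be a finite strongly connected directed graph on n vertices. For valuations f, g : V → {1,…,n}, say g is reachable from f if g is obtained from f by applying a finite (possibly empty) sequence of asynchronous maximum updates. If f is a valuation such that for every valuation g reachable from f, the valuation f is also reachable from g (i.e., f lies in an absorbing strongly connected component of the Markov chain of possibilities), then f is a constant valuation. Consequently the period of the asynchronous maximum model on a strongly connected directed graph is 1. -/
open MeasureTheory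
open scoped ENNReal

attribute [local instance] Classical.propDecidable

/-- The out-neighbours of `v` in the directed graph with edge relation `E`, as a finset. -/
noncomputable def outNbrs {V : Type*} [Fintype V] (E : V → V → Prop) (v : V) : Finset V :=
  Finset.univ.filter (fun u => E v u)

/-- The asynchronous maximum update of a valuation `f` at the vertex `v` in a directed graph:
the value at `v` is replaced by the maximum of `f` over the out-neighbours of `v` (if `v` has
at least one out-neighbour; otherwise nothing changes), and all other values are unchanged. -/
noncomputable def dUpdate {V : Type*} [Fintype V] (E : V → V → Prop)
    (f : V → ℕ) (v : V) : V → ℕ :=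
  fun u => if u = v ∧ (outNbrs E v).Nonempty then (outNbrs E v).sup f else f u

/-- `g` is reachable from `f` if it is obtained from `f` by a finite (possibly empty)
sequence of asynchronous maximum updates. -/
def dReachable {V : Type*} [Fintype V] (E : V → V → Prop) : (V → ℕ) → (V → ℕ) → Prop :=
  Relation.ReflTransGen (fun f g => ∃ v, g = dUpdate E f v)

/-- An update at a vertex with an out-neighbour of maximal value `M` produces the value `M`. -/
lemma dUpdate_eq_update_of_edge {V : Type*} [Fintype V] {E : V → V → Prop} {f : V → ℕ} {M : ℕ}
    (hle : ∀ v, f v ≤ M) {a b : V} (hab : E a b) (hb : f b = M) :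
    dUpdate E f a = Function.update f a M := by
  have hmem : b ∈ outNbrs E a := by simp [outNbrs, hab]
  have hsup : (outNbrs E a).sup f = M :=
    le_antisymm (Finset.sup_le fun v _ => hle v) (hb ▸ Finset.le_sup hmem)
  have hne : (outNbrs E a).Nonempty := ⟨b, hmem⟩
  funext u
  by_cases hu : u = a
  · subst hu
    simp [dUpdate, hne, hsup]
  · simp [dUpdate, hu]

/-- On a strongly connected directed graph, the constant valuation at the maximum of `f` is
reachable from `f`. -/
lemma dReachable_const_of_isGreatest {V : Type*} [Fintype V] {E : V → V → Prop}
    (hsc : ∀ u v : V, Relation.ReflTransGen E u v) {M : ℕ} (f : V → ℕ)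
    (hM : IsGreatest (Set.range f) M) : dReachable E f (fun _ => M) := by
  induction hk : (Finset.univ.filter fun v => f v ≠ M).card using Nat.strong_induction_on
    generalizing f with
  | _ k ih =>
    have hle : ∀ v, f v ≤ M := fun v => hM.2 ⟨v, rfl⟩
    obtain ⟨m, hm⟩ := hM.1
    by_cases hall : ∀ v, f v = M
    · rw [show f = fun _ => M from funext hall]
      exact Relation.ReflTransGen.refl
    · obtain ⟨u, hu⟩ := not_forall.mp hall
      obtain ⟨a, b, hab, ha, hb⟩ : ∃ a b, E a b ∧ f a ≠ M ∧ f b = M := by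
        by_contra! hcross
        refine hu ?_
        clear hu
        induction hsc u m using Relation.ReflTransGen.head_induction_on with
        | refl => exact hm
        | head hac _ hc =>
          by_contra hne
          exact hcross _ _ hac hne hc
      refine Relation.ReflTransGen.head
        ⟨a, (dUpdate_eq_update_of_edge hle hab hb).symm⟩ (ih _ ?_ _ ⟨⟨a, by simp⟩, ?_⟩ rfl)
      · rw [← hk]
        refine Finset.card_lt_card (Finset.ssubset_iff_subset_ne.mpr ⟨fun v hv => ?_, fun h => ?_⟩)
        · by_cases hva : v = a
          · simp [hva] at hv
          · simpa [hva] using hv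
        · have : a ∈ Finset.univ.filter fun v => f v ≠ M := by simpa using ha
          rw [← h] at this
          simp at this
      · rintro _ ⟨v, rfl⟩
        by_cases hva : v = a
        · simp [hva]
        · simpa [hva] using hle v

/-- Updates do not change a constant valuation. -/
lemma dUpdate_const {V : Type*} [Fintype V] (E : V → V → Prop) (c : ℕ) (v : V) :
    dUpdate E (fun _ => c) v = fun _ => c := by
  funext u
  unfold dUpdate
  split_ifs with h
  · exact Finset.sup_const h.2 c
  · rfl

/-- Only the constant valuation itself is reachable from a constant valuation. -/
lemma eq_const_of_dReachable_const {V : Type*} [Fintype V] {E : V → V → Prop} {c : ℕ}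
    {g : V → ℕ} (h : dReachable E (fun _ => c) g) : g = fun _ => c := by
  induction h with
  | refl => rfl
  | tail _ hstep ih =>
    obtain ⟨v, rfl⟩ := hstep
    rw [ih, dUpdate_const]

/-- if a valuation `f` on a finite strongly connected directed graph lies in
an absorbing strongly connected component of the Markov chain of possibilities (that is, `f`
is reachable back from every valuation reachable from `f`), then `f` is a constant valuation.
Consequently the period of the asynchronous maximum model on a strongly connected directed
graph is `1`. -/
theorem absorbing_implies_const_dir {V : Type*} [Fintype V] (E : V → V → Prop)
    (n : ℕ) (hn : Fintype.card V = n)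
    (hsc : ∀ u v : V, Relation.ReflTransGen E u v)
    (f : V → ℕ) (hf : ∀ v, f v ∈ Finset.Icc 1 n)
    (habs : ∀ g : V → ℕ, dReachable E f g → dReachable E g f) :
    ∃ c : ℕ, f = fun _ => c := by
  cases isEmpty_or_nonempty V with
  | inl _ => exact ⟨0, Subsingleton.elim _ _⟩
  | inr _ =>
    obtain ⟨m, hm⟩ := Finite.exists_max f
    have hM : IsGreatest (Set.range f) (f m) :=
      ⟨⟨m, rfl⟩, by rintro _ ⟨v, rfl⟩; exact hm v⟩
    exact ⟨f m, eq_const_of_dReachable_const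
      (habs _ (dReachable_const_of_isGreatest hsc f hM))⟩
end

section
/- Let G = (V,E) be a finite strongly connected directed graph on n vertices, let f : V → {1,…,n} be a valuation, let v' ∈ V, and let f' be the result of the asynchronous maximum update of f at v'. Then the strong cycle set of f is contained in the strong cycle set of f', i.e., C_f ⊆ C_{f'}. In particular the potential function f ↦ |C_f| is nonnegative, bounded above by n, and nondecreasing along any sequence of asynchronous maximum updates. -/
open MeasureTheory
open scoped ENNReal

attribute [local instance] Classical.propDecidable

/-- `x` lies on a strong cycle of the valuation `f`: a directed cycle (a nonempty list of
distinct vertices `v :: l` with an edge between consecutive vertices and an edge from the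
last back to `v`) all of whose vertices carry the maximum value `M_f = max_v f v`. -/
def onStrongCycle {V : Type*} [Fintype V] (E : V → V → Prop) (f : V → ℕ) (x : V) : Prop :=
  ∃ (v : V) (l : List V), (v :: l).Nodup ∧ List.Chain E v (l ++ [v]) ∧
    (∀ u ∈ v :: l, f u = Finset.univ.sup f) ∧ x ∈ v :: l

/-- The strong cycle set `C_f`: all vertices `x` that either lie on a strong cycle, or admit a
directed walk, all of whose vertices carry the maximum value `M_f`, to a vertex of a strong
cycle. -/
def strongCycleSet {V : Type*} [Fintype V] (E : V → V → Prop) (f : V → ℕ) : Set V :=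
  {x | f x = Finset.univ.sup f ∧ ∃ w, onStrongCycle E f w ∧
    Relation.ReflTransGen (fun a b => E a b ∧ f b = Finset.univ.sup f) x w}

/-- In a chain ending in `v`, every vertex before the end has a successor in the chain. -/
theorem List.IsChain.exists_rel_of_mem_append_singleton {α : Type*} {R : α → α → Prop} {x v : α} :
    ∀ {l : List α}, (l ++ [v]).IsChain R → x ∈ l → ∃ z ∈ l ++ [v], R x z
  | [], _, hx => by simp at hx
  | [a], h, hx => by
    obtain rfl : x = a := by simpa using hx
    exact ⟨v, by simp, by simpa using h⟩
  | a :: b :: l, h, hx => by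
    simp only [List.cons_append, List.isChain_cons_cons] at h
    rcases List.mem_cons.mp hx with rfl | hx
    · exact ⟨b, by simp, h.1⟩
    · obtain ⟨z, hz, hxz⟩ :=
        exists_rel_of_mem_append_singleton (l := b :: l) (by simpa using h.2) hx
      exact ⟨z, List.mem_cons_of_mem _ hz, hxz⟩

section

variable {V : Type*} [Fintype V] {E : V → V → Prop} {f : V → ℕ}

theorem onStrongCycle.eq_sup {x : V} (hx : onStrongCycle E f x) : f x = Finset.univ.sup f := by
  obtain ⟨v, l, -, -, hM, hx⟩ := hx
  exact hM x hx

theorem onStrongCycle.exists_succ {x : V} (hx : onStrongCycle E f x) :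
    ∃ z, E x z ∧ f z = Finset.univ.sup f := by
  obtain ⟨v, l, -, hc, hM, hx⟩ := hx
  obtain ⟨z, hz, hxz⟩ :=
    List.IsChain.exists_rel_of_mem_append_singleton (l := v :: l) hc hx
  refine ⟨z, hxz, hM z ?_⟩
  simp only [List.mem_append, List.mem_cons, List.not_mem_nil, or_false] at hz ⊢
  tauto

theorem onStrongCycle.mem_strongCycleSet {x : V} (hx : onStrongCycle E f x) :
    x ∈ strongCycleSet E f :=
  ⟨hx.eq_sup, x, hx, .refl⟩

/-- Every vertex of the strong cycle set has an out-neighbour of maximum value. -/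
theorem exists_succ_of_mem_strongCycleSet {x : V} (hx : x ∈ strongCycleSet E f) :
    ∃ z, E x z ∧ f z = Finset.univ.sup f := by
  obtain ⟨-, w, hw, hxw⟩ := hx
  rcases hxw.cases_head with rfl | ⟨z, hz, -⟩
  · exact hw.exists_succ
  · exact ⟨z, hz⟩

theorem dUpdate_le_sup (v u : V) : dUpdate E f v u ≤ Finset.univ.sup f := by
  unfold dUpdate
  split_ifs
  · exact Finset.sup_mono (Finset.subset_univ _)
  · exact Finset.le_sup (Finset.mem_univ u)

theorem dUpdate_eq_sup_of_mem_strongCycleSet (v : V) {x : V} (hx : x ∈ strongCycleSet E f) :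
    dUpdate E f v x = Finset.univ.sup f := by
  refine le_antisymm (dUpdate_le_sup v x) ?_
  obtain ⟨z, hxz, hz⟩ := exists_succ_of_mem_strongCycleSet hx
  unfold dUpdate
  split_ifs with h
  · rw [← hz, ← h.1]
    exact Finset.le_sup (by simpa [outNbrs] using hxz)
  · exact hx.1.ge

theorem sup_dUpdate_of_mem_strongCycleSet (v : V) {x : V} (hx : x ∈ strongCycleSet E f) :
    Finset.univ.sup (dUpdate E f v) = Finset.univ.sup f :=
  le_antisymm (Finset.sup_le fun u _ => dUpdate_le_sup v u)
    ((dUpdate_eq_sup_of_mem_strongCycleSet v hx).ge.trans (Finset.le_sup (Finset.mem_univ x)))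

theorem onStrongCycle.update (v : V) {x : V} (hx : onStrongCycle E f x) :
    onStrongCycle E (dUpdate E f v) x := by
  have hsup := sup_dUpdate_of_mem_strongCycleSet v hx.mem_strongCycleSet
  obtain ⟨w, l, hnd, hc, hM, hx⟩ := hx
  refine ⟨w, l, hnd, hc, fun u hu => ?_, hx⟩
  rw [hsup]
  exact dUpdate_eq_sup_of_mem_strongCycleSet v
    (onStrongCycle.mem_strongCycleSet ⟨w, l, hnd, hc, hM, hu⟩)

theorem strongCycleSet_subset_dUpdate (v : V) :
    strongCycleSet E f ⊆ strongCycleSet E (dUpdate E f v) := by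
  intro x hx
  have hsup := sup_dUpdate_of_mem_strongCycleSet v hx
  refine ⟨(dUpdate_eq_sup_of_mem_strongCycleSet v hx).trans hsup.symm, ?_⟩
  obtain ⟨-, w, hw, hxw⟩ := hx
  refine ⟨w, hw.update v, ?_⟩
  induction hxw using Relation.ReflTransGen.head_induction_on with
  | refl => exact .refl
  | head hac hcw ih =>
    refine .head ⟨hac.1, ?_⟩ ih
    rw [hsup]
    exact dUpdate_eq_sup_of_mem_strongCycleSet v ⟨hac.2, w, hw, hcw⟩

end

/-- the strong cycle set can only grow under an asynchronous maximum update;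
in particular the potential function `f ↦ |C_f|` is nonnegative, bounded above by `n` and
nondecreasing along any sequence of updates. -/
theorem strongCycleSet_mono {V : Type*} [Fintype V] (E : V → V → Prop)
    (n : ℕ) (hn : Fintype.card V = n)
    (hsc : ∀ u v : V, Relation.ReflTransGen E u v)
    (f : V → ℕ) (hf : ∀ v, f v ∈ Finset.Icc 1 n) (v' : V) :
    strongCycleSet E f ⊆ strongCycleSet E (dUpdate E f v') ∧
    (strongCycleSet E f).ncard ≤ n := by
  refine ⟨strongCycleSet_subset_dUpdate v', ?_⟩
  rw [← hn, ← Nat.card_eq_fintype_card]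
  exact Set.ncard_le_card _
end
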